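/- Let 𝐓₂ ⊆ 𝐒 be the set of aperiodic Toeplitz subshifts that are conjugate to the S-adic subshift of some primitive, proper and recognizable directive sequence of alphabet rank at most 2 (i.e., the aperiodic Toeplitz subshifts of topological rank 2). Then the conjugacy relation on 𝐓₂ is hyperfinite: there exists a sequence (F_k)_{k≥0} of equivalence relations on 𝐓₂ such that every equivalence class of each F_k is finite, each F_k is Borel (i.e., F_k = B_k ∩ (𝐓₂ × 𝐓₂) for some Borel set B_k ⊆ 𝐒 × 𝐒), F_k ⊆ F_{k+1} for all k, and ⋃_k F_k = {(X,Y) ∈ 𝐓₂ × 𝐓₂ : (X,S) and (Y,S) are conjugate}. -/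

import Mathlib

namespace ToeplitzFR

open Set

variable {A B C : Type*}

/-- The shift map `S` on `ℤ → A`: `S(x)(i) = x(i+1)`. -/
def shift (x : ℤ → A) : ℤ → A := fun i => x (i + 1)

/-- The inverse shift map `S⁻¹`. -/
def shiftInv (x : ℤ → A) : ℤ → A := fun i => x (i - 1)

/-- The shift by `k`: `S^k`. -/
def shiftBy (k : ℤ) (x : ℤ → A) : ℤ → A := fun i => x (i + k)

/-- The finite word `x[i, i+n)`. -/
def factorAt (x : ℤ → A) (i : ℤ) (n : ℕ) : List A :=
  (List.range n).map fun j => x (i + j)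

/-- `x` is a periodic point of the shift. -/
def IsPeriodicPoint (x : ℤ → A) : Prop := ∃ p : ℕ, 0 < p ∧ ∀ i : ℤ, x (i + p) = x i

def IsAperiodicPoint (x : ℤ → A) : Prop := ¬ IsPeriodicPoint x

/-- `Per_p(x)`. -/
def PerSet (x : ℤ → A) (p : ℕ) : Set ℤ := {i : ℤ | ∀ k : ℤ, x (i + k * p) = x i}

/-- `Per(x) = ⋃_{p>1} Per_p(x)`. -/
def PerAll (x : ℤ → A) : Set ℤ := {i : ℤ | ∃ p : ℕ, 1 < p ∧ i ∈ PerSet x p}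

/-- `x` is a Toeplitz sequence. -/
def IsToeplitz (x : ℤ → A) : Prop := ∀ i : ℤ, ∃ p : ℕ, 1 < p ∧ i ∈ PerSet x p

/-- The shift orbit of `x`. -/
def orbit (x : ℤ → A) : Set (ℤ → A) := {y | ∃ k : ℤ, y = shiftBy k x}

/-- `X` is the Toeplitz subshift generated by the Toeplitz sequence `x`. -/
def ToeplitzGenerates [TopologicalSpace A] (x : ℤ → A) (X : Set (ℤ → A)) : Prop :=
  IsToeplitz x ∧ X = closure (orbit x)

/-- `X` is a Toeplitz subshift. -/
def IsToeplitzSubshift [TopologicalSpace A] (X : Set (ℤ → A)) : Prop :=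
  ∃ x : ℤ → A, ToeplitzGenerates x X

/-- The `p`-skeleton of `x`, with `none` as the blank symbol. -/
noncomputable def Skel (x : ℤ → A) (p : ℕ) : ℤ → Option A :=
  fun i => @ite _ (i ∈ PerSet x p) (Classical.dec _) (some (x i)) none

/-- `p` is an essential period of `x`. -/
def IsEssentialPeriod (x : ℤ → A) (p : ℕ) : Prop :=
  1 < p ∧ ∀ q : ℕ, 0 < q → q < p → ∃ i : ℤ, Skel x p (i + q) ≠ Skel x p i

/-- `(P n)` is a period structure for `x`. -/
def IsPeriodStructure (x : ℤ → A) (P : ℕ → ℕ) : Prop :=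
  StrictMono P ∧ (∀ n, IsEssentialPeriod x (P n)) ∧ (∀ n, P n ∣ P (n+1)) ∧
    ∀ i : ℤ, ∃ n, i ∈ PerSet x (P n)

/-- `q` divides the scale of the Toeplitz subshift `X`. -/
def DividesScale [TopologicalSpace A] (X : Set (ℤ → A)) (q : ℕ) : Prop :=
  ∃ (x : ℤ → A) (P : ℕ → ℕ),
    ToeplitzGenerates x X ∧ IsPeriodStructure x P ∧ ∃ n, q ∣ P n

/-! ### Directive sequences and S-adic subshifts -/

/-- All morphisms in the directive sequence are non-erasing. -/
def NonErasing {A : ℕ → Type*} (τ : ∀ n, A (n+1) → List (A n)) : Prop :=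
  ∀ n a, τ n a ≠ []

/-- The directive sequence has constant length. -/
def ConstantLength {A : ℕ → Type*} (τ : ∀ n, A (n+1) → List (A n)) : Prop :=
  ∀ n, ∀ a b : A (n+1), (τ n a).length = (τ n b).length

/-- The directive sequence is proper. -/
def ProperSeq {A : ℕ → Type*} (τ : ∀ n, A (n+1) → List (A n)) : Prop :=
  ∀ n, ∃ b c : A n, ∀ a : A (n+1), (τ n a).head? = some b ∧ (τ n a).getLast? = some c

/-- `sadicWordAux τ n k a = τ_{[n, n+k)}(a)`. -/
def sadicWordAux {A : ℕ → Type*} (τ : ∀ n, A (n+1) → List (A n)) (n : ℕ) :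
    ∀ k : ℕ, A (n + k) → List (A n)
  | 0, a => [a]
  | (k+1), a => (τ (n+k) a).flatMap (sadicWordAux τ n k)

/-- `word0 τ k a = τ_{[0, k)}(a)` for `a ∈ A k`. -/
def word0 {A : ℕ → Type*} (τ : ∀ n, A (n+1) → List (A n)) :
    ∀ k : ℕ, A k → List (A 0)
  | 0, a => [a]
  | (k+1), a => (τ k a).flatMap (word0 τ k)

/-- The directive sequence is primitive. -/
def PrimitiveSeq {A : ℕ → Type*} (τ : ∀ n, A (n+1) → List (A n)) : Prop :=
  ∀ n, ∃ k : ℕ, 0 < k ∧ ∀ (a : A (n+k)) (b : A n), b ∈ sadicWordAux τ n k a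

/-- The `n`-th level `X_τ^{(n)}` of the S-adic system generated by `τ`. -/
def XLevel {A : ℕ → Type*} (τ : ∀ n, A (n+1) → List (A n)) (n : ℕ) :
    Set (ℤ → A n) :=
  {y | ∀ (i : ℤ) (m : ℕ), ∃ k : ℕ, 0 < k ∧ ∃ a : A (n+k),
      (factorAt y i m).IsInfix (sadicWordAux τ n k a)}

/-- The alphabet rank (`liminf_n |A_n|`) is at most `K`. -/
def AlphabetRankLE (A : ℕ → Type*) [∀ n, Fintype (A n)] (K : ℕ) : Prop :=
  ∀ N : ℕ, ∃ n, N ≤ n ∧ Fintype.card (A n) ≤ K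

/-! ### Recognizability -/

/-- `z` is the bi-infinite concatenation `⋯σ(y(-1)).σ(y(0))σ(y(1))⋯`,
with `σ(y(0))` starting at coordinate `0`. -/
def IsConcat (σ : B → List C) (y : ℤ → B) (z : ℤ → C) : Prop :=
  ∃ c : ℤ → ℤ, c 0 = 0 ∧ (∀ j : ℤ, c (j + 1) = c j + (σ (y j)).length) ∧
    ∀ (j : ℤ) (m : Fin (σ (y j)).length), z (c j + (m : ℕ)) = (σ (y j)).get m

/-- `(y, k)` is a centered `σ`-representation of `x` in `Y`. -/
def IsCenteredRep (σ : B → List C) (Y : Set (ℤ → B)) (x : ℤ → C)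
    (y : ℤ → B) (k : ℕ) : Prop :=
  y ∈ Y ∧ k < (σ (y 0)).length ∧ IsConcat σ y (fun m => x (m - k))

/-- The morphism `σ` is recognizable in `Y`. -/
def RecognizableIn (σ : B → List C) (Y : Set (ℤ → B)) : Prop :=
  ∀ (x : ℤ → C) (y y' : ℤ → B) (k k' : ℕ),
    IsCenteredRep σ Y x y k → IsCenteredRep σ Y x y' k' → y = y' ∧ k = k'

/-- The directive sequence `τ` is recognizable. -/
def RecognizableSeq {A : ℕ → Type*} (τ : ∀ n, A (n+1) → List (A n)) : Prop :=
  ∀ n, RecognizableIn (τ n) (XLevel τ (n+1))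

/-! ### Conjugacy -/

/-- `(X, TX)` and `(Y, TY)` are conjugate via a homeomorphism. -/
def ConjugateBy [TopologicalSpace A] [TopologicalSpace B]
    (X : Set (ℤ → A)) (Y : Set (ℤ → B))
    (TX : (ℤ → A) → (ℤ → A)) (TY : (ℤ → B) → (ℤ → B)) : Prop :=
  ∃ φ : ↥X ≃ₜ ↥Y, ∀ (x : ℤ → A) (hx : x ∈ X) (hx' : TX x ∈ X),
    (φ ⟨TX x, hx'⟩).1 = TY (φ ⟨x, hx⟩).1

/-- `(X, S)` and `(Y, S)` are conjugate subshifts. -/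
def Conjugate [TopologicalSpace A] [TopologicalSpace B]
    (X : Set (ℤ → A)) (Y : Set (ℤ → B)) : Prop :=
  ConjugateBy X Y shift shift

/-- `X` is a strong Toeplitz subshift of rank `K`: it is conjugate to the S-adic subshift
of a constant-length, primitive, proper and recognizable directive sequence of
alphabet rank at most `K`. -/
def IsStrongToeplitzOfRank [TopologicalSpace A] (X : Set (ℤ → A)) (K : ℕ) : Prop :=
  ∃ (B : ℕ → Type) (iB : ∀ n, Fintype (B n)) (σ : ∀ n, B (n+1) → List (B n)),
    NonErasing σ ∧ ConstantLength σ ∧ PrimitiveSeq σ ∧ ProperSeq σ ∧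
    RecognizableSeq σ ∧ @AlphabetRankLE B iB K ∧
    @Conjugate A (B 0) _ ⊥ X (XLevel σ 0)

/-- `X` is conjugate to the S-adic subshift of a primitive, proper and recognizable
directive sequence of alphabet rank at most `K`. -/
def HasFiniteRankSAdicRep [TopologicalSpace A] (X : Set (ℤ → A)) (K : ℕ) : Prop :=
  ∃ (B : ℕ → Type) (iB : ∀ n, Fintype (B n)) (σ : ∀ n, B (n+1) → List (B n)),
    NonErasing σ ∧ PrimitiveSeq σ ∧ ProperSeq σ ∧
    RecognizableSeq σ ∧ @AlphabetRankLE B iB K ∧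
    @Conjugate A (B 0) _ ⊥ X (XLevel σ 0)

/-! ### Cuts, languages, built-from -/

/-- The set of words `{x[t+kp, t+(k+1)p) : k ∈ ℤ}`. -/
def cutWords (x : ℤ → A) (p t : ℕ) : Set (List A) :=
  {w | ∃ k : ℤ, w = factorAt x ((t : ℤ) + k * p) p}

/-- `(p, t)` is a strong rank-2 cut of `x`. -/
def StrongRank2Cut (x : ℤ → A) (p t : ℕ) : Prop :=
  t < p ∧ ∃ u v : List A, u ≠ v ∧ cutWords x p t = {u, v}

/-- The language `L_n(X)`. -/
def Lang (n : ℕ) (X : Set (ℤ → A)) : Set (List A) :=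
  {w | ∃ x ∈ X, ∃ i : ℤ, w = factorAt x i n}

/-- The maximal common prefix of `u` and `v` has length greater than `m`. -/
def CommonPrefixLongerThan (u v : List A) (m : ℕ) : Prop :=
  m + 1 ≤ u.length ∧ m + 1 ≤ v.length ∧ u.take (m+1) = v.take (m+1)

/-- The maximal common suffix of `u` and `v` has length greater than `m`. -/
def CommonSuffixLongerThan (u v : List A) (m : ℕ) : Prop :=
  CommonPrefixLongerThan u.reverse v.reverse m

/-- `b = (β₀, (α₁, …, α_k), β₁)` is a building of the word `w` from `W`:
`w = β₀α₁⋯α_kβ₁`, all `αᵢ ∈ W`, `β₀` is a proper suffix of an element of `W`,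
and `β₁` is a proper prefix of an element of `W`. -/
def IsBuilding (W : Set (List A)) (w : List A)
    (b : List A × List (List A) × List A) : Prop :=
  w = b.1 ++ b.2.1.flatten ++ b.2.2 ∧ (∀ α ∈ b.2.1, α ∈ W) ∧
  (∃ u ∈ W, b.1 <:+ u ∧ b.1 ≠ u) ∧ (∃ u ∈ W, b.2.2 <+: u ∧ b.2.2 ≠ u)

/-- `w` is uniquely built from `W`. -/
def UniquelyBuiltFrom (W : Set (List A)) (w : List A) : Prop :=
  ∃! b : List A × List (List A) × List A, IsBuilding W w b

/-- `X` together with one of its points satisfies the strong rank-2 cut property. -/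
def GoodCuts [TopologicalSpace A] (X : Set (ℤ → A)) (x : ℤ → A) : Prop :=
  ∀ p : ℕ, 0 < p → DividesScale X p → ∀ m : ℕ,
    ∃ q t : ℕ, StrongRank2Cut x q t ∧ p ∣ q ∧ DividesScale X q ∧
      ∃ u v : List A, u ≠ v ∧ cutWords x q t = {u, v} ∧
        CommonPrefixLongerThan u v m ∧ CommonSuffixLongerThan u v m

/-! ### Euclidean pairs and buildings of bi-infinite sequences -/

/-- `{u, v}` is a Euclidean pair. -/
def EuclideanPair (u v : List A) : Prop :=
  ∃ (w : List A) (k l : ℕ),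
    u = (List.replicate k w).flatten ∧ v = (List.replicate l w).flatten

/-- `α` is the distinguished prefix of `u` and `v`. -/
def IsDistinguishedPrefix (u v α : List A) : Prop :=
  α.length < u.length + v.length ∧
  ∀ x y : List A,
    (∃ l : List (List A), (∀ w ∈ l, w = u ∨ w = v) ∧ x = u ++ l.flatten) →
    (∃ l : List (List A), (∀ w ∈ l, w = u ∨ w = v) ∧ y = v ++ l.flatten) →
    α.length + 1 ≤ x.length → α.length + 1 ≤ y.length →
    α <+: x ∧ α <+: y ∧ x[α.length]? ≠ y[α.length]?

/-- `β` is the distinguished suffix of `u` and `v`. -/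
def IsDistinguishedSuffix (u v β : List A) : Prop :=
  IsDistinguishedPrefix u.reverse v.reverse β.reverse

/-- `(c, f)` is a building of the bi-infinite sequence `x` from `W`:
block `j` starts at position `c j` and carries the word `f j ∈ W`. -/
def IsBuildingSeq (W : Set (List A)) (x : ℤ → A) (c : ℤ → ℤ) (f : ℤ → List A) : Prop :=
  (∀ j : ℤ, f j ∈ W) ∧ (∀ j : ℤ, c (j + 1) = c j + (f j).length) ∧
  ∀ (j : ℤ) (m : Fin (f j).length), x (c j + (m : ℕ)) = (f j).get m

/-- The subshift `X_{u,v}` of all sequences built from `{u, v}`. -/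
def Xuv (u v : List A) : Set (ℤ → A) :=
  {x | ∃ (c : ℤ → ℤ) (f : ℤ → List A), IsBuildingSeq {u, v} x c f}

/-! ### Block-code conjugacies -/

/-- A conjugacy `φ : X → Y` admitting block width `2n+1`. -/
structure BlockConjugacy (A : Type*) (X Y : Set (ℤ → A)) (n : ℕ) where
  toFun : (ℤ → A) → (ℤ → A)
  invFun : (ℤ → A) → (ℤ → A)
  maps_to : ∀ x ∈ X, toFun x ∈ Y
  maps_from : ∀ y ∈ Y, invFun y ∈ X
  left_inv : ∀ x ∈ X, invFun (toFun x) = x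
  right_inv : ∀ y ∈ Y, toFun (invFun y) = y
  shift_comm : ∀ x ∈ X, toFun (shift x) = shift (toFun x)
  code : List A → A
  code_inv : List A → A
  code_spec : ∀ x ∈ X, ∀ i : ℤ, toFun x i = code (factorAt x (i - n) (2*n+1))
  code_inv_spec : ∀ y ∈ Y, ∀ i : ℤ, invFun y i = code_inv (factorAt y (i - n) (2*n+1))

/-! ### Parts, permutation action, χ -/

/-- `W` is a member of `Parts(X, p)`: a class of the common-`p`-skeleton relation. -/
def SkelClass (X : Set (ℤ → A)) (p : ℕ) (W : Set (ℤ → A)) : Prop :=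
  ∃ y ∈ X, W = {z ∈ X | Skel z p = Skel y p}

/-- The map `ψ̂` induced by a permutation `ψ` of `A^p`. -/
def permHat (p : ℕ) (ψ : Equiv.Perm (Fin p → A)) (x : ℤ → A) : ℤ → A :=
  fun i =>
    if h : (i.emod p).toNat < p then
      ψ (fun m : Fin p => x (i - i.emod p + (m : ℕ))) ⟨(i.emod p).toNat, h⟩
    else x i

/-- The relation `E_p` on compact subsets of `A^ℤ`. -/
def EpRel (p : ℕ) (K L : Set (ℤ → A)) : Prop :=
  ∃ ψ : Equiv.Perm (Fin p → A), L = permHat p ψ '' K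

/-- `W ∈ Parts_*(X, p)`. -/
def SkelClassStar (X : Set (ℤ → A)) (p : ℕ) (W : Set (ℤ → A)) : Prop :=
  SkelClass X p W ∧ ∀ y ∈ W, Skel y p (-1) = none ∧ Skel y p 0 ≠ none

/-- `length(W) = L` for `W ∈ Parts_*(X, p)`. -/
def HasLength (p : ℕ) (W : Set (ℤ → A)) (L : ℕ) : Prop :=
  ∀ y ∈ W, (∀ i : ℕ, i < L → Skel y p (i : ℤ) ≠ none) ∧ Skel y p (L : ℤ) = none

/-- `Z ∈ χ(X, p)`. -/
def ChiMem (X : Set (ℤ → A)) (p : ℕ) (Z : Set (ℤ → A)) : Prop :=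
  ∃ (W : Set (ℤ → A)) (L : ℕ), SkelClassStar X p W ∧ HasLength p W L ∧
    (∀ (W' : Set (ℤ → A)) (L' : ℕ),
      SkelClassStar X p W' → HasLength p W' L' → L' ≤ L) ∧
    Z = shiftBy ((L / 2 : ℕ) : ℤ) '' W

/-- `χ(X, p) E_p^fin χ(Y, p)`. -/
def ChiEpFin (X Y : Set (ℤ → A)) (p : ℕ) : Prop :=
  (∀ K, ChiMem X p K → ∃ L, ChiMem Y p L ∧ EpRel p K L) ∧
  (∀ L, ChiMem Y p L → ∃ K, ChiMem X p K ∧ EpRel p K L)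

/-! ### Single holes and fillings -/

/-- The Toeplitz sequence `x` has single holes with respect to the period structure `P`. -/
def SingleHoles (x : ℤ → A) (P : ℕ → ℕ) : Prop :=
  IsPeriodStructure x P ∧
  ∀ n, ∃! i : ℤ, 0 ≤ i ∧ i < (P n : ℤ) ∧ i ∉ PerSet x (P n)

/-- The Toeplitz subshift `X` has single holes. -/
def HasSingleHoles [TopologicalSpace A] (X : Set (ℤ → A)) : Prop :=
  ∃ (x : ℤ → A) (P : ℕ → ℕ), ToeplitzGenerates x X ∧ SingleHoles x P

/-- `w` is the `(n, m)`-filling of `x` (for periods `pn < pm`). -/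
def IsFilling (x : ℤ → A) (pn pm : ℕ) (w : List A) : Prop :=
  w.length = pm / pn - 1 ∧
  ∀ h : ℤ, 0 ≤ h → h < (pm : ℤ) → h ∉ PerSet x pm →
    ∀ (j : ℕ) (hj : j < w.length), w.get ⟨j, hj⟩ = x (h + (j+1) * pn)

/-- `u` is a `θ`-palindrome. -/
def ThetaPalindrome (θ : Equiv.Perm A) (u : List A) : Prop :=
  u.map (fun a => θ a) = u.reverse

/-! ### Nice symmetries -/

/-- `x` has nice symmetries with respect to `(p, q)`. -/
def NiceSymmetries (x : ℤ → A) (p q : ℕ) : Prop :=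
  ∃ m : ℤ, 1 < m ∧ m ≤ (q : ℤ) + 1 ∧
    (∀ k : ℕ, k < q / p →
      (Set.Ico ((k * p : ℕ) : ℤ) (((k+1) * p : ℕ) : ℤ) ⊆ PerSet x q ↔
       Set.Ico (m - ((k+1) * p : ℕ)) (m - (k * p : ℕ)) ⊆ PerSet x q)) ∧
    (∀ k k' : ℕ, k < q / p → k' < q / p →
      Set.Ico ((k * p : ℕ) : ℤ) (((k+1) * p : ℕ) : ℤ) ⊆ PerSet x q →
      Set.Ico ((k' * p : ℕ) : ℤ) (((k'+1) * p : ℕ) : ℤ) ⊆ PerSet x q →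
      (factorAt x ((k * p : ℕ) : ℤ) p = factorAt x ((k' * p : ℕ) : ℤ) p ↔
       factorAt x (m - ((k+1) * p : ℕ)) p = factorAt x (m - ((k'+1) * p : ℕ)) p))

/-- For some `p` dividing the scale of `X`, `x` has nice symmetries with respect to
`(p, q)` for all `q > p` with `p ∣ q` dividing the scale of `X`. -/
def NiceSymAll [TopologicalSpace A] (X : Set (ℤ → A)) (x : ℤ → A) : Prop :=
  ∃ p : ℕ, 0 < p ∧ DividesScale X p ∧
    ∀ q : ℕ, p < q → p ∣ q → DividesScale X q → NiceSymmetries x p q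

/-- A pair `(x, x')` is a centered left asymptotic pair. -/
def CenteredLeftAsymptoticPair (x x' : ℤ → A) : Prop :=
  (∀ i : ℤ, i < 0 → x i = x' i) ∧ x 0 ≠ x' 0

/-! ### Automorphism groups -/

/-- `e` is an automorphism of the subshift `(X, S)`. -/
def IsShiftAutomorphism [TopologicalSpace A] (X : Set (ℤ → A)) (e : ↥X ≃ₜ ↥X) : Prop :=
  ∀ (x : ℤ → A) (hx : x ∈ X) (hx' : shift x ∈ X),
    (e ⟨shift x, hx'⟩).1 = shift (e ⟨x, hx⟩).1

/-- The automorphism group of `(X, S)` is isomorphic, as a group, to `ℤ × ℤ/nℤ`. -/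
def AutGroupIsoZxZmod [TopologicalSpace A] (X : Set (ℤ → A)) (n : ℕ) : Prop :=
  ∃ Φ : {e : ↥X ≃ₜ ↥X // IsShiftAutomorphism X e} → ℤ × ZMod n,
    Function.Bijective Φ ∧
    ∀ e f g : {e : ↥X ≃ₜ ↥X // IsShiftAutomorphism X e},
      (∀ z : ↥X, g.1 z = e.1 (f.1 z)) → Φ g = Φ e + Φ f

/-! ### The Polish space of subshifts over `ℤ` -/

/-- A point of the space `𝐒` of all (compact, nonempty, shift-invariant) subshifts
over finite alphabets contained in `ℤ`. -/
structure SubshiftSpace : Type where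
  carrier : Set (ℤ → ℤ)
  nonempty : carrier.Nonempty
  compact : IsCompact carrier
  invariant : shift '' carrier = carrier

/-- The topology on `𝐒` induced by the languages `(L_n(X))_{n}`, with each
family of `n`-languages discrete; this coincides with the metric
`d(X,Y) = 2^{-min{n : L_n(X) ≠ L_n(Y)}}`. -/
instance : TopologicalSpace SubshiftSpace :=
  TopologicalSpace.induced
    (fun X : SubshiftSpace => (fun n => Lang n X.carrier : ℕ → Set (List ℤ)))
    (@Pi.topologicalSpace ℕ (fun _ => Set (List ℤ)) (fun _ => ⊥))

/-- The subset `𝐌 ⊆ 𝐒` of infinite minimal subshifts. -/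
def MinimalSet : Set SubshiftSpace :=
  {X | X.carrier.Infinite ∧ ∀ x ∈ X.carrier, X.carrier ⊆ closure (orbit x)}


/-- The set `𝐓₂` of aperiodic Toeplitz subshifts of topological rank 2 in the space
`𝐒`. -/
def T2Set : Set SubshiftSpace :=
  {X | IsToeplitzSubshift X.carrier ∧ (∀ x ∈ X.carrier, IsAperiodicPoint x) ∧
       HasFiniteRankSAdicRep X.carrier 2}


/-! ### Helper material: word pairs and parsing -/

/-- The length of the longest common prefix (0 if the lists are equal). -/
noncomputable def lcpLen (l l' : List A) : ℕ := sInf {i : ℕ | l[i]? ≠ l'[i]?}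

lemma lcpLen_agree {l l' : List A} {i : ℕ} (h : i < lcpLen l l') : l[i]? = l'[i]? := by
  by_contra hne
  exact absurd (Nat.sInf_le (s := {i : ℕ | l[i]? ≠ l'[i]?}) hne) (not_le.mpr h)

lemma lcpLen_ne {l l' : List A} (h : l ≠ l') : l[lcpLen l l']? ≠ l'[lcpLen l l']? := by
  have : {i : ℕ | l[i]? ≠ l'[i]?}.Nonempty := by
    by_contra hne
    apply h
    apply List.ext_getElem?
    intro i
    by_contra hi
    exact hne ⟨i, hi⟩
  exact Nat.sInf_mem this

lemma lcpLen_self (l : List A) : lcpLen l l = 0 := by simp [lcpLen]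

lemma lcpLen_lt {l l' : List A} (h : l ≠ l') (hl : l.length = l'.length) :
    lcpLen l l' < l.length := by
  by_contra hge
  push Not at hge
  apply lcpLen_ne h
  rw [List.getElem?_eq_none hge, List.getElem?_eq_none (hl ▸ hge)]

lemma le_lcpLen {l l' : List A} (h : l ≠ l') {m : ℕ} (hm : ∀ i < m, l[i]? = l'[i]?) :
    m ≤ lcpLen l l' := by
  by_contra hlt
  push Not at hlt
  exact lcpLen_ne h (hm _ hlt)

noncomputable def dA (w : Bool → List A) : ℕ :=
  lcpLen (w false ++ w true) (w true ++ w false)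

def wrev (w : Bool → List A) : Bool → List A := fun c => (w c).reverse

noncomputable def dB (w : Bool → List A) : ℕ := dA (wrev w)

noncomputable def depth (w : Bool → List A) : ℕ := dA w + dB w

def tlen (w : Bool → List A) : ℕ := (w false).length + (w true).length

def NonC (w : Bool → List A) : Prop := w false ++ w true ≠ w true ++ w false

lemma NonC.rev {w : Bool → List A} (h : NonC w) : NonC (wrev w) := by
  intro he
  apply h
  have := congrArg List.reverse he
  simpa [wrev] using this.symm

lemma tlen_wrev (w : Bool → List A) : tlen (wrev w) = tlen w := by simp [tlen, wrev]

lemma dA_lt {w : Bool → List A} (h : NonC w) : dA w < tlen w := by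
  have := lcpLen_lt h (by simp [add_comm])
  simpa [dA, tlen] using this

lemma dA_le (w : Bool → List A) : dA w ≤ tlen w := by
  by_cases h : NonC w
  · exact (dA_lt h).le
  · have : w false ++ w true = w true ++ w false := by simpa [NonC] using h
    rw [dA, this, lcpLen_self]; exact Nat.zero_le _

lemma dB_lt {w : Bool → List A} (h : NonC w) : dB w < tlen w := by
  rw [dB, ← tlen_wrev]; exact dA_lt h.rev

lemma depth_le (w : Bool → List A) : depth w ≤ 2 * tlen w := by
  have h1 := dA_le w
  have h2 := dA_le (wrev w)
  rw [tlen_wrev] at h2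
  unfold depth dB; omega

lemma dA_agree {w : Bool → List A} {i : ℕ} (h : i < dA w) (c : Bool) :
    (w c ++ w (!c))[i]? = (w false ++ w true)[i]? := by
  cases c
  · rfl
  · exact (lcpLen_agree h).symm

lemma dA_ne {w : Bool → List A} (h : NonC w) {c c' : Bool} (hc : c ≠ c') :
    (w c ++ w (!c))[dA w]? ≠ (w c' ++ w (!c'))[dA w]? := by
  have := lcpLen_ne h
  cases c <;> cases c' <;> simp at hc ⊢
  · exact this
  · exact this.symm

/-- `l` is a prefix of the stream `s`. -/
def Pre (l : List A) (s : ℕ → A) : Prop := ∀ i, i < l.length → l[i]? = some (s i)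

/-- All streams in `G` parse into words of `w`. -/
def StartsIn (w : Bool → List A) (G : Set (ℕ → A)) (c : Bool) (s : ℕ → A) : Prop :=
  0 < (w c).length ∧ Pre (w c) s ∧ (fun m => s (m + (w c).length)) ∈ G

def ParseSet (w : Bool → List A) (G : Set (ℕ → A)) : Prop :=
  ∀ s ∈ G, ∃ c, StartsIn w G c s

lemma parse_main {w : Bool → List A} {G : Set (ℕ → A)} (hG : ParseSet w G) (i : ℕ) :
    i ≤ dA w → i < tlen w → ∀ s c, StartsIn w G c s → some (s i) = (w c ++ w (!c))[i]? := by
  induction i using Nat.strong_induction_on with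
  | _ i ih =>
    intro hd hl s c hs
    obtain ⟨h0, hp, ht⟩ := hs
    by_cases hi : i < (w c).length
    · rw [List.getElem?_append_left hi, hp i hi]
    · push Not at hi
      rw [List.getElem?_append_right hi]
      obtain ⟨c', hc'⟩ := hG _ ht
      have hlt : i - (w c).length < i := by omega
      have h1 := ih (i - (w c).length) hlt (by omega) (by omega) _ c' hc'
      have h2 : (i - (w c).length) < dA w := by omega
      rw [dA_agree h2, ← dA_agree h2 (!c)] at h1
      have h3 : i - (w c).length < (w (!c)).length := by
        unfold tlen at hl; cases c <;> simp at * <;> omega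
      rw [List.getElem?_append_left h3] at h1
      rw [← h1, Nat.sub_add_cancel hi]

lemma parse_agree {w : Bool → List A} {G : Set (ℕ → A)} (hG : ParseSet w G) {i : ℕ}
    (hi : i < dA w) {s s' : ℕ → A} (hs : s ∈ G) (hs' : s' ∈ G) : s i = s' i := by
  obtain ⟨c, hc⟩ := hG s hs
  obtain ⟨c', hc'⟩ := hG s' hs'
  have hl := lt_of_lt_of_le hi (dA_le w)
  have h1 := parse_main hG i hi.le hl s c hc
  have h2 := parse_main hG i hi.le hl s' c' hc'
  rw [dA_agree hi] at h1 h2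
  rw [← h1] at h2
  exact (Option.some.inj h2).symm

lemma parse_differ {w : Bool → List A} {G : Set (ℕ → A)} (hG : ParseSet w G)
    (hw : NonC w) {s s' : ℕ → A} {c c' : Bool} (hc : StartsIn w G c s)
    (hc' : StartsIn w G c' s') (hne : c ≠ c') : s (dA w) ≠ s' (dA w) := by
  have h1 := parse_main hG _ le_rfl (dA_lt hw) s c hc
  have h2 := parse_main hG _ le_rfl (dA_lt hw) s' c' hc'
  intro he
  rw [he, h2] at h1
  exact dA_ne hw hne h1.symm

/-- In the commuting case, prefixing by `u` does not change the stream. -/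
lemma parse_comm {w : Bool → List A} {G : Set (ℕ → A)} (hG : ParseSet w G)
    (hw : ¬ NonC w) (c : Bool) (i : ℕ) : ∀ s ∈ G, 
      (if h : i < (w c).length then (w c)[i] = s i else s (i - (w c).length) = s i) := by
  have hcomm : ∀ d, w c ++ w d = w d ++ w c := by
    have : w false ++ w true = w true ++ w false := by simpa [NonC] using hw
    intro d
    cases c <;> cases d <;> simp [this]
  induction i using Nat.strong_induction_on with
  | _ i ih =>
    intro s hs
    obtain ⟨d, h0, hp, ht⟩ := hG s hs
    -- compare `(w c ++ s) i` with `s i` by shifting over `w d`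
    have hcd := hcomm d
    have key : ∀ j, j < (w c).length + (w d).length → (w d ++ w c)[j]? =
        some (if h : j < (w c).length then (w c)[j] else s (j - (w c).length)) := by
      intro j hj
      rw [← hcd]
      by_cases h : j < (w c).length
      · rw [List.getElem?_append_left h]; simp [h]
      · push Not at h
        rw [List.getElem?_append_right h, hp _ (by omega)]
        simp [not_lt.mpr h]
    by_cases hi : i < (w d).length
    · have h1 := key i (by omega)
      rw [List.getElem?_append_left hi, hp i hi] at h1
      have h2 := Option.some.inj h1
      split_ifs at h2 ⊢ with h
      · exact h2.symm
      · exact h2.symm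
    · push Not at hi
      have h1 := ih (i - (w d).length) (by omega) _ ht
      rw [Nat.sub_add_cancel hi] at h1
      by_cases hi2 : i < (w c).length + (w d).length
      · have h2 := key i hi2
        have h3 : i - (w d).length < (w c).length := by omega
        rw [dif_pos h3] at h1
        rw [List.getElem?_append_right hi, List.getElem?_eq_getElem h3] at h2
        have h4 := Option.some.inj h2
        rw [h1] at h4
        split_ifs at h4 ⊢ with h
        · exact h4.symm
        · exact h4.symm
      · rw [dif_neg (by omega)] at h1
        rw [dif_neg (by omega)]
        rw [← h1]
        congr 1
        omega

lemma parse_periodic {w : Bool → List A} {G : Set (ℕ → A)} (hG : ParseSet w G)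
    (hw : ¬ NonC w) (c : Bool) (s : ℕ → A) (hs : s ∈ G) (i : ℕ) :
    s (i + (w c).length) = s i := by
  have := parse_comm hG hw c (i + (w c).length) s hs
  rw [dif_neg (by omega), Nat.add_sub_cancel] at this
  exact this.symm

/-! ### Towers -/

def Adj {L : Type*} (ℓ : L → ℕ) (a b : L × ℕ) : Prop :=
  (a.2 + 1 < ℓ a.1 ∧ b = (a.1, a.2 + 1)) ∨ (a.2 + 1 = ℓ a.1 ∧ b.2 = 0)

def Tow {L : Type*} (ℓ : L → ℕ) (τ : ℤ → L × ℕ) : Prop := ∀ i, Adj ℓ (τ i) (τ (i + 1))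

def Fills {L : Type*} (w : L → List A) (τ : ℤ → L × ℕ) (x : ℤ → A) : Prop :=
  ∀ i, (w (τ i).1)[(τ i).2]? = some (x i)

def len {L : Type*} (w : L → List A) : L → ℕ := fun c => (w c).length

section tow
variable {L : Type*} {ℓ : L → ℕ} {τ : ℤ → L × ℕ}

lemma Tow.lt (h : Tow ℓ τ) (i : ℤ) : (τ i).2 < ℓ (τ i).1 := by
  rcases h i with h | h
  · omega
  · omega

lemma Tow.fwd (h : Tow ℓ τ) {i : ℤ} {c : L} {j : ℕ} (hi : τ i = (c, j)) (m : ℕ)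
    (hm : j + m < ℓ c) : τ (i + m) = (c, j + m) := by
  induction m with
  | zero => simpa using hi
  | succ m ih =>
    have h1 := ih (by omega)
    rcases h (i + m) with h2 | h2
    · rw [h1] at h2
      have : i + ((m + 1 : ℕ) : ℤ) = i + m + 1 := by push_cast; ring
      rw [this, h2.2]; rfl
    · rw [h1] at h2
      simp at h2; omega

lemma Tow.back (h : Tow ℓ τ) {i : ℤ} {c : L} {j : ℕ} (hi : τ i = (c, j)) (m : ℕ)
    (hm : m ≤ j) : τ (i - m) = (c, j - m) := by
  induction m with
  | zero => simpa using hi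
  | succ m ih =>
    have h1 := ih (by omega)
    have e : i - ((m + 1 : ℕ) : ℤ) + 1 = i - m := by push_cast; ring
    have h2 := h (i - ((m + 1 : ℕ) : ℤ))
    rw [e, h1] at h2
    rcases h2 with ⟨h2, h3⟩ | ⟨h2, h3⟩
    · rw [Prod.ext_iff] at h3
      simp only at h3
      ext
      · exact h3.1.symm
      · simp only; omega
    · simp only at h3; omega

lemma Tow.next (h : Tow ℓ τ) {i : ℤ} {c : L} {j : ℕ} (hi : τ i = (c, j)) :
    (τ (i + (ℓ c - j : ℕ))).2 = 0 := by
  have hlt := h.lt i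
  rw [hi] at hlt
  simp only at hlt
  have h1 := h.fwd hi (ℓ c - j - 1) (by omega)
  have h2 := h (i + (ℓ c - j - 1 : ℕ))
  have e : i + ((ℓ c - j - 1 : ℕ) : ℤ) + 1 = i + (ℓ c - j : ℕ) := by omega
  rw [e, h1] at h2
  rcases h2 with h2 | h2
  · simp only at h2; omega
  · exact h2.2

lemma Tow.cut (h : Tow ℓ τ) {i : ℤ} {c : L} {j : ℕ} (hi : τ i = (c, j)) :
    τ (i - j) = (c, 0) := by
  have := h.back hi j le_rfl
  simpa using this

lemma Tow.prev (h : Tow ℓ τ) {i : ℤ} (hi : (τ i).2 = 0) :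
    (τ (i - 1)).2 + 1 = ℓ (τ (i - 1)).1 := by
  have h2 := h (i - 1)
  rw [sub_add_cancel] at h2
  rcases h2 with h2 | h2
  · rw [h2.2] at hi; simp at hi
  · exact h2.1

lemma Tow.prev_eq (h : Tow ℓ τ) {i : ℤ} (hi : (τ i).2 = 0) {c : L} (hc : (τ (i - 1)).1 = c)
    (m : ℕ) (hm : m < ℓ c) : τ (i - 1 - m) = (c, ℓ c - 1 - m) := by
  have h1 := h.prev hi
  rw [hc] at h1
  have h2 : τ (i - 1) = (c, ℓ c - 1) := by
    ext
    · exact hc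
    · simp only; omega
  exact h.back h2 m (by omega)

end tow

/-- The set of futures of cuts. -/
def futSet (w : Bool → List A) : Set (ℕ → A) :=
  {s | ∃ τ x, ∃ i : ℤ, Tow (len w) τ ∧ Fills w τ x ∧ (τ i).2 = 0 ∧ s = fun m : ℕ => x (i + m)}

def pastSet (w : Bool → List A) : Set (ℕ → A) :=
  {s | ∃ τ x, ∃ i : ℤ, Tow (len w) τ ∧ Fills w τ x ∧ (τ i).2 = 0 ∧
    s = fun m : ℕ => x (i - 1 - m)}

section two
variable {w : Bool → List A} {τ τ' : ℤ → Bool × ℕ} {x x' : ℤ → A}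

lemma fut_starts (h : Tow (len w) τ) (hf : Fills w τ x) {i : ℤ} (hi : (τ i).2 = 0) :
    StartsIn w (futSet w) (τ i).1 (fun m : ℕ => x (i + m)) := by
  have h0 : τ i = ((τ i).1, 0) := by rw [← hi]
  refine ⟨?_, ?_, ?_⟩
  · have := h.lt i; unfold len at this; omega
  · intro m hm
    have h1 := h.fwd h0 m (by simpa [len] using hm)
    have h2 := hf (i + m)
    rw [h1] at h2
    simpa using h2
  · refine ⟨τ, x, i + (len w (τ i).1 : ℕ), h, hf, ?_, ?_⟩
    · have := h.next h0
      simpa using this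
    · funext m
      show x _ = x _
      congr 1
      simp only [len]; push_cast; ring

lemma past_starts (h : Tow (len w) τ) (hf : Fills w τ x) {i : ℤ} (hi : (τ i).2 = 0) :
    StartsIn (wrev w) (pastSet w) (τ (i - 1)).1 (fun m : ℕ => x (i - 1 - m)) := by
  have hl : (wrev w (τ (i - 1)).1).length = len w (τ (i-1)).1 := by simp [wrev, len]
  have h0 := h.prev hi
  refine ⟨?_, ?_, ?_⟩
  · rw [hl]; omega
  · intro m hm
    rw [hl] at hm
    have h1 := h.prev_eq hi rfl m hm
    have h2 := hf (i - 1 - m)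
    rw [h1] at h2
    simp only at h2
    rw [← h2]
    unfold wrev
    rw [List.getElem?_reverse (by simpa [len] using hm)]
    rfl
  · rw [hl]
    refine ⟨τ, x, i - (len w (τ (i-1)).1 : ℕ), h, hf, ?_, ?_⟩
    · have := h.prev_eq hi rfl (len w (τ (i-1)).1 - 1) (by omega)
      have e : i - 1 - ((len w (τ (i-1)).1 - 1 : ℕ) : ℤ) = i - (len w (τ (i-1)).1 : ℕ) := by omega
      rw [e] at this
      rw [this]; simp
    · funext m
      show x _ = x _
      congr 1
      push_cast; ring

lemma futSet_parse (w : Bool → List A) : ParseSet w (futSet w) := by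
  rintro s ⟨τ, x, i, h, hf, hi, rfl⟩
  exact ⟨_, fut_starts h hf hi⟩

lemma pastSet_parse (w : Bool → List A) : ParseSet (wrev w) (pastSet w) := by
  rintro s ⟨τ, x, i, h, hf, hi, rfl⟩
  exact ⟨_, past_starts h hf hi⟩

lemma cut_agree_fut (h : Tow (len w) τ) (hf : Fills w τ x) (h' : Tow (len w) τ')
    (hf' : Fills w τ' x') {i i' : ℤ} (hi : (τ i).2 = 0) (hi' : (τ' i').2 = 0) {m : ℕ}
    (hm : m < dA w) : x (i + m) = x' (i' + m) :=
  parse_agree (futSet_parse w) hm (s := fun m : ℕ => x (i + m)) (s' := fun m : ℕ => x' (i' + m))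
    ⟨τ, x, i, h, hf, hi, rfl⟩ ⟨τ', x', i', h', hf', hi', rfl⟩

lemma cut_agree_past (h : Tow (len w) τ) (hf : Fills w τ x) (h' : Tow (len w) τ')
    (hf' : Fills w τ' x') {i i' : ℤ} (hi : (τ i).2 = 0) (hi' : (τ' i').2 = 0) {m : ℕ}
    (hm : m < dB w) : x (i - 1 - m) = x' (i' - 1 - m) :=
  parse_agree (pastSet_parse w) hm (s := fun m : ℕ => x (i - 1 - m))
    (s' := fun m : ℕ => x' (i' - 1 - m))
    ⟨τ, x, i, h, hf, hi, rfl⟩ ⟨τ', x', i', h', hf', hi', rfl⟩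

lemma fills_eq (hf : Fills w τ x) (hf' : Fills w τ' x') {i i' : ℤ} (e : τ i = τ' i') :
    x i = x' i' := by
  have h1 := hf i
  rw [e, hf' i'] at h1
  exact (Option.some.inj h1).symm

lemma agree_window (h : Tow (len w) τ) (hf : Fills w τ x) (h' : Tow (len w) τ')
    (hf' : Fills w τ' x') {i i' : ℤ} (e : τ i = τ' i') {t : ℤ} (h1 : -(dB w : ℤ) ≤ t)
    (h2 : t ≤ dA w) : x (i + t) = x' (i' + t) := by
  obtain ⟨⟨c, j⟩, hcj⟩ : ∃ a, τ i = a := ⟨_, rfl⟩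
  have hcj' := hcj
  rw [e] at hcj'
  have hlt := h.lt i
  rw [hcj] at hlt
  simp only at hlt
  by_cases ht0 : t < -(j : ℤ)
  · have a := h.cut hcj
    have a' := h'.cut hcj'
    have := cut_agree_past h hf h' hf' (i := i - j) (i' := i' - j) (by rw [a]) (by rw [a'])
      (m := (-(j : ℤ) - t - 1).toNat) (by omega)
    convert this using 2 <;> omega
  · by_cases ht1 : t < (len w c : ℤ) - j
    · apply fills_eq hf hf'
      by_cases ht2 : 0 ≤ t
      · have a := h.fwd hcj t.toNat (by omega)
        have a' := h'.fwd hcj' t.toNat (by omega)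
        rw [Int.toNat_of_nonneg ht2] at a a'
        rw [a, a']
      · have a := h.back hcj (-t).toNat (by omega)
        have a' := h'.back hcj' (-t).toNat (by omega)
        rw [Int.toNat_of_nonneg (by omega), sub_neg_eq_add] at a a'
        rw [a, a']
    · have a := h.next hcj
      have a' := h'.next hcj'
      have := cut_agree_fut h hf h' hf' a a' (m := (t - (len w c - j : ℕ)).toNat) (by omega)
      convert this using 2 <;> omega

lemma left_branch (hw : NonC w) (h : Tow (len w) τ) (hf : Fills w τ x) (h' : Tow (len w) τ')
    (hf' : Fills w τ' x') {i0 : ℤ} (hlt : ∀ i < i0, τ i = τ' i) (hne : τ i0 ≠ τ' i0) :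
    (∀ i < i0 + dA w, x i = x' i) ∧ x (i0 + dA w) ≠ x' (i0 + dA w) := by
  have e := hlt (i0 - 1) (by omega)
  have h1 := h (i0 - 1)
  have h1' := h' (i0 - 1)
  rw [sub_add_cancel] at h1 h1'
  rw [e] at h1
  have hc : (τ i0).2 = 0 ∧ (τ' i0).2 = 0 := by
    rcases h1 with h1 | h1 <;> rcases h1' with h1' | h1'
    · exact absurd (h1.2.trans h1'.2.symm) hne
    · omega
    · omega
    · exact ⟨h1.2, h1'.2⟩
  have hl : (τ i0).1 ≠ (τ' i0).1 := fun he => hne (Prod.ext he (hc.1.trans hc.2.symm))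
  refine ⟨fun i hi => ?_, ?_⟩
  · by_cases hi0 : i < i0
    · exact fills_eq hf hf' (hlt i hi0)
    · have := cut_agree_fut h hf h' hf' hc.1 hc.2 (m := (i - i0).toNat) (by omega)
      convert this using 2 <;> omega
  · exact parse_differ (futSet_parse w) hw (fut_starts h hf hc.1) (fut_starts h' hf' hc.2) hl

lemma right_branch (hw : NonC w) (h : Tow (len w) τ) (hf : Fills w τ x) (h' : Tow (len w) τ')
    (hf' : Fills w τ' x') {i0 : ℤ} (hgt : ∀ i > i0, τ i = τ' i) (hne : τ i0 ≠ τ' i0) :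
    (∀ i > i0 - dB w, x i = x' i) ∧ x (i0 - dB w) ≠ x' (i0 - dB w) := by
  have e := hgt (i0 + 1) (by omega)
  have h1 := h i0
  have h1' := h' i0
  rw [e] at h1
  have hcut : (τ' (i0 + 1)).2 = 0 := by
    rcases h1 with h1 | h1
    · rcases h1' with h1' | h1'
      · exfalso
        apply hne
        have := h1.2.symm.trans h1'.2
        rw [Prod.ext_iff] at this
        simp only at this
        exact Prod.ext this.1 (by omega)
      · exact h1'.2
    · exact h1.2
  have hc : (τ (i0 + 1)).2 = 0 := by rw [e]; exact hcut
  have p := h.prev hc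
  have p' := h'.prev hcut
  rw [add_sub_cancel_right] at p p'
  have hl : (τ i0).1 ≠ (τ' i0).1 := fun he => hne (Prod.ext he (by rw [he] at p; omega))
  refine ⟨fun i hi => ?_, ?_⟩
  · by_cases hi0 : i0 < i
    · exact fills_eq hf hf' (hgt i hi0)
    · have := cut_agree_past h hf h' hf' hc hcut (m := (i0 - i).toNat) (by omega)
      convert this using 2 <;> omega
  · have a := past_starts h hf hc
    have a' := past_starts h' hf' hcut
    have := parse_differ (pastSet_parse w) hw.rev a a' (by simpa using hl)
    have e2 : i0 + 1 - 1 - ((dA (wrev w) : ℕ) : ℤ) = i0 - dB w := by rw [dB]; ring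
    rw [e2] at this
    exact this

lemma nonC_of_aperiodic (h : Tow (len w) τ) (hf : Fills w τ x) (hx : IsAperiodicPoint x) :
    NonC w := by
  by_contra hw
  apply hx
  -- pick a nonempty word
  have hpos : 0 < (w (τ 0).1).length := by
    have := h.lt 0; unfold len at this; omega
  refine ⟨(w (τ 0).1).length, hpos, fun i => ?_⟩
  obtain ⟨⟨c, j⟩, hcj⟩ : ∃ a, τ i = a := ⟨_, rfl⟩
  have hc := h.cut hcj
  have := parse_periodic (futSet_parse w) hw (τ 0).1 (fun m : ℕ => x (i - j + m))
    ⟨τ, x, i - j, h, hf, by rw [hc], rfl⟩ j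
  push_cast at this
  convert this using 2 <;> ring

end two

/-! ### Locality and compactness -/

def IsLoc (r : ℕ) (f : (ℤ → A) → (ℤ → B)) : Prop :=
  ∀ x y i i', (∀ j : ℤ, -(r : ℤ) ≤ j → j ≤ r → x (i + j) = y (i' + j)) → f x i = f y i'

lemma IsLoc.comp {r s : ℕ} {f : (ℤ → B) → (ℤ → C)} {g : (ℤ → A) → (ℤ → B)}
    (hf : IsLoc r f) (hg : IsLoc s g) : IsLoc (r + s) (f ∘ g) := by
  intro x y i i' h
  apply hf
  intro j h1 h2
  apply hg
  intro j' h1' h2'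
  have := h (j + j') (by push_cast; omega) (by push_cast; omega)
  simpa [add_assoc] using this

lemma IsLoc.shiftBy (k : ℤ) : IsLoc (A := A) k.natAbs (shiftBy k) := by
  intro x y i i' h
  exact h k (by omega) (by omega)

lemma IsLoc.shift_comm {r : ℕ} {f : (ℤ → A) → (ℤ → B)} (hf : IsLoc r f) (k : ℤ) (x : ℤ → A) :
    f (ToeplitzFR.shiftBy k x) = ToeplitzFR.shiftBy k (f x) := by
  funext i
  apply hf
  intro j _ _
  show x _ = x _
  congr 1; ring

lemma IsLoc.mono {r s : ℕ} {f : (ℤ → A) → (ℤ → B)} (hf : IsLoc r f) (h : r ≤ s) :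
    IsLoc s f := fun x y i i' hh => hf x y i i' fun j h1 h2 => hh j (by omega) (by omega)

lemma shiftBy_add (k l : ℤ) (x : ℤ → A) : shiftBy k (shiftBy l x) = shiftBy (k + l) x := by
  funext i; simp [shiftBy, add_assoc]

lemma shiftBy_zero (x : ℤ → A) : shiftBy 0 x = x := by
  funext i; simp [shiftBy]

lemma shift_eq (x : ℤ → A) : shift x = shiftBy 1 x := rfl

lemma IsLoc.continuous [TopologicalSpace A] [DiscreteTopology A] [TopologicalSpace B]
    {r : ℕ} {f : (ℤ → A) → (ℤ → B)} (hf : IsLoc r f) : Continuous f := by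
  refine continuous_pi fun i => ?_
  refine IsLocallyConstant.continuous ?_
  rw [IsLocallyConstant.iff_exists_open]
  intro x
  refine ⟨Set.pi (Set.Icc (i - r) (i + r)) (fun j => {x j}), ?_, by simp [Set.mem_pi], ?_⟩
  · exact isOpen_set_pi (Set.finite_Icc _ _) fun j _ => isOpen_discrete _
  · intro y hy
    apply hf
    intro j h1 h2
    simp only [Set.mem_pi, Set.mem_Icc, Set.mem_singleton_iff] at hy
    exact hy (i + j) ⟨by omega, by omega⟩

/-- Agreement of `π` on a finite window determines `q`. -/
lemma pat {Ω C D : Type*} [TopologicalSpace Ω] [CompactSpace Ω]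
    [TopologicalSpace C] [DiscreteTopology C] [TopologicalSpace D] [DiscreteTopology D]
    {π : Ω → ℤ → C} (hπ : ∀ i, Continuous fun ω => π ω i) {q : Ω → D} (hq : Continuous q)
    (h : ∀ ω ω', (∀ i, π ω i = π ω' i) → q ω = q ω') :
    ∃ r : ℕ, ∀ ω ω', (∀ i : ℤ, -(r : ℤ) ≤ i → i ≤ r → π ω i = π ω' i) → q ω = q ω' := by
  let U : ℕ → Set (Ω × Ω) := fun r =>
    {p | q p.1 = q p.2} ∪ ⋃ i ∈ Set.Icc (-(r : ℤ)) r, {p | π p.1 i ≠ π p.2 i}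
  have ho : ∀ r, IsOpen (U r) := by
    intro r
    refine IsOpen.union ?_ (isOpen_biUnion fun i _ => ?_)
    · exact (isOpen_discrete {p : D × D | p.1 = p.2}).preimage
        ((hq.comp continuous_fst).prodMk (hq.comp continuous_snd))
    · exact (isOpen_discrete {p : C × C | p.1 ≠ p.2}).preimage
        (((hπ i).comp continuous_fst).prodMk ((hπ i).comp continuous_snd))
  have hm : Monotone U := by
    intro r s hrs
    refine Set.union_subset_union_right _ ?_
    refine Set.biUnion_subset_biUnion_left ?_
    intro i hi
    simp only [Set.mem_Icc] at hi ⊢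
    omega
  obtain ⟨r, hr⟩ := isCompact_univ.elim_directed_cover U ho (by
    rintro ⟨ω, ω'⟩ -
    rw [Set.mem_iUnion]
    by_cases hh : ∀ i, π ω i = π ω' i
    · exact ⟨0, Or.inl (h _ _ hh)⟩
    · push Not at hh
      obtain ⟨i, hi⟩ := hh
      refine ⟨i.natAbs, Or.inr ?_⟩
      rw [Set.mem_iUnion₂]
      exact ⟨i, by simp only [Set.mem_Icc]; omega, hi⟩) hm.directed_le
  refine ⟨r, fun ω ω' hh => ?_⟩
  rcases hr (Set.mem_univ (ω, ω')) with h1 | h1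
  · exact h1
  · rw [Set.mem_iUnion₂] at h1
    obtain ⟨i, hi, hne⟩ := h1
    exact absurd (hh i hi.1 hi.2) hne

/-- Abstract Curtis–Hedlund–Lyndon. -/
lemma local_of_inj {Ω : Type*} [TopologicalSpace Ω] [CompactSpace Ω] [Nonempty B]
    [TopologicalSpace A] [DiscreteTopology A] [TopologicalSpace B] [DiscreteTopology B]
    {π : Ω → ℤ → A} {ρ : Ω → ℤ → B} (hπ : ∀ i, Continuous fun ω => π ω i)
    (hρ : Continuous fun ω => ρ ω 0)
    (hs : ∀ ω k, ∃ ω', π ω' = shiftBy k (π ω) ∧ ρ ω' = shiftBy k (ρ ω))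
    (h : ∀ ω ω', π ω = π ω' → ρ ω 0 = ρ ω' 0) :
    ∃ r h, IsLoc r h ∧ ∀ ω, h (π ω) = ρ ω := by
  classical
  obtain ⟨r, hr⟩ := pat hπ hρ (fun ω ω' hh => h ω ω' (funext hh))
  let P : (ℤ → A) → ℤ → Ω → Prop := fun x i ω =>
    ∀ j : ℤ, -(r : ℤ) ≤ j → j ≤ r → π ω j = x (i + j)
  let F : (ℤ → A) → ℤ → B := fun x i =>
    if hh : ∃ ω, P x i ω then ρ hh.choose 0 else Classical.arbitrary B
  have hF : ∀ x i ω, P x i ω → F x i = ρ ω 0 := by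
    intro x i ω hω
    have hh : ∃ ω, P x i ω := ⟨ω, hω⟩
    simp only [F, dif_pos hh]
    apply hr
    intro j h1 h2
    rw [hh.choose_spec j h1 h2, hω j h1 h2]
  refine ⟨r, F, ?_, ?_⟩
  · intro x y i i' hxy
    by_cases hh : ∃ ω, P x i ω
    · obtain ⟨ω, hω⟩ := hh
      rw [hF x i ω hω, hF y i' ω]
      intro j h1 h2
      rw [hω j h1 h2, hxy j h1 h2]
    · have hh' : ¬ ∃ ω, P y i' ω := by
        rintro ⟨ω, hω⟩
        exact hh ⟨ω, fun j h1 h2 => by rw [hω j h1 h2, hxy j h1 h2]⟩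
      simp only [F, dif_neg hh, dif_neg hh']
  · intro ω
    funext i
    obtain ⟨ω', h1, h2⟩ := hs ω i
    rw [hF (π ω) i ω', h2]
    · simp [shiftBy]
    · intro j _ _
      rw [h1]; simp [shiftBy, add_comm]

/-- Local conjugacies. -/
structure LConj (X : Set (ℤ → A)) (Y : Set (ℤ → B)) (f : (ℤ → A) → (ℤ → B))
    (g : (ℤ → B) → (ℤ → A)) : Prop where
  locf : ∃ r, IsLoc r f
  locg : ∃ r, IsLoc r g
  mapf : ∀ x ∈ X, f x ∈ Y
  mapg : ∀ y ∈ Y, g y ∈ X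
  gf : ∀ x ∈ X, g (f x) = x
  fg : ∀ y ∈ Y, f (g y) = y

lemma LConj.symm {X : Set (ℤ → A)} {Y : Set (ℤ → B)} {f g} (h : LConj X Y f g) :
    LConj Y X g f := ⟨h.locg, h.locf, h.mapg, h.mapf, h.fg, h.gf⟩

def Inv (X : Set (ℤ → A)) : Prop := ∀ x ∈ X, ∀ k, shiftBy k x ∈ X

lemma inv_of_shift {X : Set (ℤ → A)} (h : shift '' X = X) : Inv X := by
  have h1 : ∀ x ∈ X, shiftBy 1 x ∈ X := fun x hx => by
    rw [← h]; exact ⟨x, hx, rfl⟩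
  have h2 : ∀ x ∈ X, shiftBy (-1) x ∈ X := fun x hx => by
    rw [← h] at hx
    obtain ⟨y, hy, rfl⟩ := hx
    rw [shift_eq, shiftBy_add]
    simpa [shiftBy_zero] using hy
  intro x hx k
  induction k using Int.induction_on with
  | zero => rwa [shiftBy_zero]
  | succ k ih =>
    rw [add_comm, ← shiftBy_add]; exact h1 _ ih
  | pred k ih =>
    rw [sub_eq_add_neg, add_comm, ← shiftBy_add]; exact h2 _ ih

lemma LConj.inv {X : Set (ℤ → A)} {Y : Set (ℤ → B)} {f g} (h : LConj X Y f g) (hX : Inv X) :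
    Inv Y := by
  intro y hy k
  obtain ⟨r, hr⟩ := h.locf
  rw [← h.fg y hy, ← hr.shift_comm]
  exact h.mapf _ (hX _ (h.mapg y hy) k)

lemma LConj.aper {X : Set (ℤ → A)} {Y : Set (ℤ → B)} {f g} (h : LConj X Y f g)
    (hX : ∀ x ∈ X, IsAperiodicPoint x) : ∀ y ∈ Y, IsAperiodicPoint y := by
  rintro y hy ⟨p, hp, hper⟩
  obtain ⟨r, hr⟩ := h.locg
  refine hX _ (h.mapg y hy) ⟨p, hp, fun i => ?_⟩
  apply hr
  intro j _ _
  rw [← hper (i + j)]; congr 1; ring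

lemma LConj.compact [TopologicalSpace A] [DiscreteTopology A] [TopologicalSpace B]
    {X : Set (ℤ → A)} {Y : Set (ℤ → B)} {f g} (h : LConj X Y f g)
    (hX : IsCompact X) : IsCompact Y := by
  obtain ⟨r, hr⟩ := h.locf
  have : Y = f '' X := by
    ext y
    exact ⟨fun hy => ⟨g y, h.mapg y hy, h.fg y hy⟩, by rintro ⟨x, hx, rfl⟩; exact h.mapf x hx⟩
  rw [this]
  exact hX.image hr.continuous

lemma LConj.conjugate [TopologicalSpace A] [DiscreteTopology A] [TopologicalSpace B]
    [DiscreteTopology B]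
    {X : Set (ℤ → A)} {Y : Set (ℤ → B)} {f g} (h : LConj X Y f g) : Conjugate X Y := by
  obtain ⟨r, hr⟩ := h.locf
  obtain ⟨s, hs⟩ := h.locg
  refine ⟨⟨⟨fun x => ⟨f x.1, h.mapf _ x.2⟩, fun y => ⟨g y.1, h.mapg _ y.2⟩, fun x => ?_,
    fun y => ?_⟩, ?_, ?_⟩, ?_⟩
  · exact Subtype.ext (h.gf _ x.2)
  · exact Subtype.ext (h.fg _ y.2)
  · exact (hr.continuous.comp continuous_subtype_val).subtype_mk _
  · exact (hs.continuous.comp continuous_subtype_val).subtype_mk _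
  · intro x hx hx'
    exact hr.shift_comm 1 x

lemma chl [TopologicalSpace A] [DiscreteTopology A] [TopologicalSpace B]
    [DiscreteTopology B] [Nonempty B] {X : Set (ℤ → A)} {Y : Set (ℤ → B)} (hc : IsCompact X)
    (hX : Inv X) (φ : X → Y) (hφ : Continuous φ)
    (hcomm : ∀ (x : ℤ → A) (hx : x ∈ X) (hx' : shift x ∈ X),
      (φ ⟨shift x, hx'⟩).1 = shift (φ ⟨x, hx⟩).1) :
    ∃ r f, IsLoc r f ∧ ∀ x : X, f x.1 = (φ x).1 := by
  have : CompactSpace X := isCompact_iff_compactSpace.mp hc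
  have up : ∀ x y : X, y.1 = shiftBy 1 x.1 → (φ y).1 = shiftBy 1 (φ x).1 := by
    rintro ⟨x, hx⟩ ⟨y, hy⟩ h
    simp only at h
    subst h
    exact hcomm x hx hy
  have key : ∀ (k : ℤ) (x y : X), y.1 = shiftBy k x.1 → (φ y).1 = shiftBy k (φ x).1 := by
    intro k
    induction k using Int.induction_on with
    | zero =>
      intro x y h
      rw [shiftBy_zero] at h ⊢
      rw [Subtype.ext h]
    | succ k ih =>
      intro x y h
      have h1 := ih x ⟨shiftBy k x.1, hX _ x.2 k⟩ rfl
      rw [up ⟨shiftBy k x.1, hX _ x.2 k⟩ y, h1, shiftBy_add, add_comm]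
      rw [h]
      show _ = shiftBy 1 (shiftBy k x.1)
      rw [shiftBy_add, add_comm]
    | pred k ih =>
      intro x y h
      have h1 := ih x ⟨shiftBy (-k) x.1, hX _ x.2 (-k)⟩ rfl
      rw [up y] at h1
      · have h2 := congrArg (shiftBy (-1)) h1
        rw [shiftBy_add, shiftBy_add, neg_add_cancel, shiftBy_zero] at h2
        rw [h2]; congr 1; ring
      · rw [h, shiftBy_add]
        show shiftBy (-k : ℤ) x.1 = _
        congr 1; ring
  refine local_of_inj (Ω := X) (π := fun x => x.1) (ρ := fun x => (φ x).1) ?_ ?_ ?_ ?_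
  · intro i
    exact (continuous_apply i).comp continuous_subtype_val
  · exact (continuous_apply 0).comp (continuous_subtype_val.comp hφ)
  · intro x k
    exact ⟨⟨shiftBy k x.1, hX _ x.2 k⟩, rfl, key k x _ rfl⟩
  · intro x x' hh
    rw [Subtype.ext hh]

lemma lconj_of_conjugate [TopologicalSpace A] [DiscreteTopology A] [TopologicalSpace B]
    [DiscreteTopology B] {X : Set (ℤ → A)} {Y : Set (ℤ → B)} (hc : IsCompact X)
    (hX : Inv X) (hne : X.Nonempty) (h : Conjugate X Y) : ∃ f g, LConj X Y f g := by
  obtain ⟨φ, hφ⟩ := h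
  obtain ⟨x0, hx0⟩ := hne
  have : Nonempty A := ⟨x0 0⟩
  have : Nonempty B := ⟨(φ ⟨x0, hx0⟩).1 0⟩
  obtain ⟨r, f, hf, hf'⟩ := chl hc hX φ φ.continuous hφ
  have hfc := hf.continuous
  have hYf : Y = f '' X := by
    ext y
    constructor
    · intro hy
      refine ⟨(φ.symm ⟨y, hy⟩).1, (φ.symm ⟨y, hy⟩).2, ?_⟩
      rw [hf']; simp
    · rintro ⟨x, hx, rfl⟩
      rw [hf' ⟨x, hx⟩]; exact (φ _).2
  have hYc : IsCompact Y := by rw [hYf]; exact hc.image hfc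
  have hYi : Inv Y := by
    rw [hYf]
    rintro _ ⟨x, hx, rfl⟩ k
    exact ⟨shiftBy k x, hX x hx k, hf.shift_comm k x⟩
  have hφ' : ∀ (y : ℤ → B) (hy : y ∈ Y) (hy' : shift y ∈ Y),
      (φ.symm ⟨shift y, hy'⟩).1 = shift (φ.symm ⟨y, hy⟩).1 := by
    intro y hy hy'
    have hx' := hX _ (φ.symm ⟨y, hy⟩).2 1
    have h1 := hφ _ (φ.symm ⟨y, hy⟩).2 hx'
    have h2 : (⟨shift y, hy'⟩ : Y) = φ ⟨shift (φ.symm ⟨y, hy⟩).1, hx'⟩ := by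
      apply Subtype.ext
      rw [h1]; simp
    rw [h2]; simp
  obtain ⟨s, g, hg, hg'⟩ := chl hYc hYi φ.symm φ.symm.continuous hφ'
  refine ⟨f, g, ⟨r, hf⟩, ⟨s, hg⟩, ?_, ?_, ?_, ?_⟩
  · intro x hx; rw [hf' ⟨x, hx⟩]; exact (φ _).2
  · intro y hy; rw [hg' ⟨y, hy⟩]; exact (φ.symm _).2
  · intro x hx; rw [hf' ⟨x, hx⟩, hg']; simp
  · intro y hy; rw [hg' ⟨y, hy⟩, hf']; simp

/-! ### Asymptotic pairs -/

def LPair (X : Set (ℤ → A)) (z z' : ℤ → A) (s : ℤ) : Prop :=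
  z ∈ X ∧ z' ∈ X ∧ (∀ i < s, z i = z' i) ∧ z s ≠ z' s

def RPair (X : Set (ℤ → A)) (z z' : ℤ → A) (s : ℤ) : Prop :=
  z ∈ X ∧ z' ∈ X ∧ (∀ i > s, z i = z' i) ∧ z s ≠ z' s

lemma exists_LPair [TopologicalSpace A] [DiscreteTopology A] {X : Set (ℤ → A)}
    (hc : IsCompact X) (hX : Inv X) (hne : X.Nonempty) (hap : ∀ x ∈ X, IsAperiodicPoint x) :
    ∃ z z' s, LPair X z z' s := by
  by_contra hno
  have hdet : ∀ x ∈ X, ∀ x' ∈ X, ∀ s, (∀ i < s, x i = x' i) → x s = x' s := by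
    intro x hx x' hx' s hs
    by_contra hh
    exact hno ⟨x, x', s, hx, hx', hs, hh⟩
  have : CompactSpace X := isCompact_iff_compactSpace.mp hc
  obtain ⟨r, hr⟩ := pat (Ω := X) (π := fun x i => if i < 0 then x.1 i else x.1 (-1))
    (q := fun x => x.1 0) (by
      intro i
      by_cases hi : i < 0
      · simp only [if_pos hi]; exact (continuous_apply i).comp continuous_subtype_val
      · simp only [if_neg hi]; exact (continuous_apply _).comp continuous_subtype_val)
    ((continuous_apply 0).comp continuous_subtype_val) (by
      intro x x' hh
      apply hdet _ x.2 _ x'.2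
      intro i hi
      simpa [hi] using hh i)
  -- determinism on windows
  have hr' : ∀ x ∈ X, ∀ i i' : ℤ, (∀ j : ℕ, j < r + 1 → x (i - 1 - j) = x (i' - 1 - j)) → x i = x i' := by
    intro x hx i i' hh
    have := hr ⟨shiftBy i x, hX x hx i⟩ ⟨shiftBy i' x, hX x hx i'⟩ (by
      intro j h1 h2
      by_cases hj : j < 0
      · simp only [if_pos hj, shiftBy]
        have := hh (-j - 1).toNat (by omega)
        convert this using 2 <;> omega
      · simp only [if_neg hj, shiftBy]
        have := hh 0 (by omega)
        convert this using 2 <;> simp <;> ring)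
    simpa [shiftBy] using this
  obtain ⟨x, hx⟩ := hne
  -- finitely many windows
  let win : ℤ → (Fin (r + 1) → A) := fun i j => x (i - 1 - (j : ℕ))
  have hfin : (Set.range win).Finite := by
    have h1 : IsCompact ((fun y : ℤ → A => fun j : Fin (r + 1) => y (-1 - (j : ℕ))) '' X) :=
      hc.image (continuous_pi fun j => continuous_apply _)
    refine (isCompact_iff_finite.mp h1).subset ?_
    rintro _ ⟨i, rfl⟩
    refine ⟨shiftBy i x, hX x hx i, ?_⟩
    funext j
    simp only [shiftBy, win]
    congr 1; ring
  obtain ⟨N, hN⟩ : ∃ N, N = hfin.toFinset.card := ⟨_, rfl⟩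
  apply hap x hx
  refine ⟨N.factorial, Nat.factorial_pos _, fun i => ?_⟩
  -- pigeonhole
  obtain ⟨p, hp, q, hq, hpq, hwin⟩ : ∃ p ∈ Finset.range (N + 1), ∃ q ∈ Finset.range (N + 1),
      p ≠ q ∧ win (i - N + p) = win (i - N + q) := by
    apply Finset.exists_ne_map_eq_of_card_lt_of_maps_to (t := hfin.toFinset)
    · rw [← hN]; simp
    · intro p _
      simp
  wlog hlt : p < q generalizing p q
  · exact this q hq p hp hpq.symm hwin.symm (by omega)
  simp only [Finset.mem_range] at hp hq
  obtain ⟨d, rfl⟩ : ∃ d, q = p + d := ⟨q - p, by omega⟩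
  have hper : ∀ m : ℕ, ∀ m' ≤ m, x (i - N + p + m' - (r + 1)) = x (i - N + p + m' - (r + 1) + d) := by
    intro m
    induction m with
    | zero =>
      intro m' hm'
      obtain rfl : m' = 0 := by omega
      have := congrFun hwin ⟨r, by omega⟩
      simp only [win] at this
      convert this using 2 <;> push_cast <;> ring
    | succ m ih =>
      intro m' hm'
      by_cases h1 : m' ≤ m
      · exact ih m' h1
      · obtain rfl : m' = m + 1 := by omega
        by_cases h2 : m + 1 < r + 1
        · have := congrFun hwin ⟨r - (m + 1), by omega⟩
          simp only [win] at this
          convert this using 2 <;> push_cast [Nat.cast_sub (show m + 1 ≤ r by omega)] <;> ring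
        · apply hr' x hx
          intro j hj
          have := ih (m - j) (by omega)
          convert this using 2 <;> push_cast [Nat.cast_sub (show j ≤ m by omega)] <;> ring
  have hper' : ∀ t : ℤ, i ≤ t → x (t + d) = x t := by
    intro t ht
    have := hper (t - (i - N + p) + (r + 1)).toNat _ le_rfl
    rw [Int.toNat_of_nonneg (by omega)] at this
    rw [eq_comm]
    convert this using 2 <;> ring
  obtain ⟨e, he⟩ : d ∣ N.factorial := Nat.dvd_factorial (by omega) (by omega)
  rw [he]
  have : ∀ e : ℕ, x (i + ((d * e : ℕ) : ℤ)) = x i := by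
    intro e
    induction e with
    | zero => simp
    | succ e ih =>
      rw [← ih, ← hper' (i + ((d * e : ℕ) : ℤ)) (by omega)]
      congr 1; push_cast; ring
  exact this e

lemma exists_RPair [TopologicalSpace A] [DiscreteTopology A] {X : Set (ℤ → A)}
    (hc : IsCompact X) (hX : Inv X) (hne : X.Nonempty) (hap : ∀ x ∈ X, IsAperiodicPoint x) :
    ∃ z z' s, RPair X z z' s := by
  let R : (ℤ → A) → (ℤ → A) := fun x i => x (-i)
  have hRR : ∀ x, R (R x) = x := fun x => by funext i; simp [R]
  obtain ⟨z, z', s, hz, hz', h1, h2⟩ := exists_LPair (X := R '' X)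
    (hc.image (continuous_pi fun i => continuous_apply _))
    (by
      rintro _ ⟨x, hx, rfl⟩ k
      refine ⟨shiftBy (-k) x, hX x hx _, ?_⟩
      funext i
      simp only [R, shiftBy]; congr 1; ring)
    (hne.image R)
    (by
      rintro _ ⟨x, hx, rfl⟩ ⟨p, hp, hper⟩
      refine hap x hx ⟨p, hp, fun i => ?_⟩
      have := hper (-i - p)
      simp only [R] at this
      rw [eq_comm]
      convert this using 2 <;> ring)
  refine ⟨R z, R z', -s, ?_, ?_, ?_, ?_⟩
  · obtain ⟨x, hx, rfl⟩ := hz; rwa [hRR]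
  · obtain ⟨x, hx, rfl⟩ := hz'; rwa [hRR]
  · intro i hi; exact h1 (-i) (by omega)
  · simpa [R] using h2

/-! ### Two-tower structures on subshifts -/

def Str (X : Set (ℤ → A)) (T : Set (ℤ → Bool × ℕ)) (w : Bool → List A) : Prop :=
  ∃ r h, IsLoc r h ∧ (∀ x ∈ X, Tow (len w) (h x) ∧ Fills w (h x) x) ∧ T = h '' X

lemma Str.nonC {X : Set (ℤ → A)} {T w} (h : Str X T w) (hne : X.Nonempty)
    (hap : ∀ x ∈ X, IsAperiodicPoint x) : NonC w := by
  obtain ⟨r, h, -, h1, -⟩ := h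
  obtain ⟨x, hx⟩ := hne
  exact nonC_of_aperiodic (h1 x hx).1 (h1 x hx).2 (hap x hx)

lemma tlen_eq {w : Bool → List A} {w' : Bool → List B} (h : len w' = len w) :
    tlen w' = tlen w := by
  have h1 := congrFun h false
  have h2 := congrFun h true
  simp only [len] at h1 h2
  simp [tlen, h1, h2]

lemma branch_left {x y : ℤ → A} (hne : x ≠ y) {a : ℤ} (h : ∀ i < a, x i = y i) :
    ∃ s, (∀ i < s, x i = y i) ∧ x s ≠ y s := by
  classical
  have hex : ∃ n : ℕ, x (a + n) ≠ y (a + n) := by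
    by_contra hh
    push Not at hh
    apply hne
    funext i
    by_cases hi : i < a
    · exact h i hi
    · have := hh (i - a).toNat
      rw [Int.toNat_of_nonneg (by omega)] at this
      simpa using this
  refine ⟨a + Nat.find hex, fun i hi => ?_, Nat.find_spec hex⟩
  by_cases hia : i < a
  · exact h i hia
  · have := Nat.find_min hex (m := (i - a).toNat) (by omega)
    rw [Int.toNat_of_nonneg (by omega)] at this
    simpa using this

lemma branch_right {x y : ℤ → A} (hne : x ≠ y) {a : ℤ} (h : ∀ i > a, x i = y i) :
    ∃ s, (∀ i > s, x i = y i) ∧ x s ≠ y s := by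
  obtain ⟨s, h1, h2⟩ := branch_left (x := fun i => x (-i)) (y := fun i => y (-i)) (a := -a)
    (fun e => hne (by funext i; have := congrFun e (-i); simpa using this))
    (fun i hi => h (-i) (by omega))
  exact ⟨-s, fun i hi => by have := h1 (-i) (by omega); simpa using this, h2⟩

lemma LPair.uniq {X : Set (ℤ → A)} {z z' s s'} (h : LPair X z z' s)
    (h1 : ∀ i < s', z i = z' i) (h2 : z s' ≠ z' s') : s = s' := by
  rcases lt_trichotomy s s' with hh | hh | hh
  · exact absurd (h1 _ hh) h.2.2.2
  · exact hh
  · exact absurd (h.2.2.1 _ hh) h2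

lemma RPair.uniq {X : Set (ℤ → A)} {z z' s s'} (h : RPair X z z' s)
    (h1 : ∀ i > s', z i = z' i) (h2 : z s' ≠ z' s') : s = s' := by
  rcases lt_trichotomy s s' with hh | hh | hh
  · exact absurd (h.2.2.1 _ hh) h2
  · exact hh
  · exact absurd (h1 _ hh) h.2.2.2

lemma LPair.map {X : Set (ℤ → A)} {Y : Set (ℤ → B)} {f g} (h : LConj X Y f g) {z z' s}
    (hp : LPair X z z' s) : ∃ J, LPair Y (f z) (f z') J := by
  obtain ⟨r, hr⟩ := h.locf
  obtain ⟨hz, hz', h1, h2⟩ := hp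
  have hne : f z ≠ f z' := by
    intro e
    have := congrArg g e
    rw [h.gf z hz, h.gf z' hz'] at this
    exact h2 (by rw [this])
  obtain ⟨J, h3, h4⟩ := branch_left hne (a := s - r) (fun i hi => hr _ _ _ _ fun j _ _ =>
    h1 _ (by omega))
  exact ⟨J, h.mapf z hz, h.mapf z' hz', h3, h4⟩

lemma RPair.map {X : Set (ℤ → A)} {Y : Set (ℤ → B)} {f g} (h : LConj X Y f g) {z z' s}
    (hp : RPair X z z' s) : ∃ J, RPair Y (f z) (f z') J := by
  obtain ⟨r, hr⟩ := h.locf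
  obtain ⟨hz, hz', h1, h2⟩ := hp
  have hne : f z ≠ f z' := by
    intro e
    have := congrArg g e
    rw [h.gf z hz, h.gf z' hz'] at this
    exact h2 (by rw [this])
  obtain ⟨J, h3, h4⟩ := branch_right hne (a := s + r) (fun i hi => hr _ _ _ _ fun j _ _ =>
    h1 _ (by omega))
  exact ⟨J, h.mapf z hz, h.mapf z' hz', h3, h4⟩

lemma transfer {X : Set (ℤ → A)} {Y : Set (ℤ → B)} {f g} (h : LConj X Y f g) {r : ℕ}
    (hr : IsLoc r f) (hX : Inv X) (hap : ∀ x ∈ X, IsAperiodicPoint x)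
    {z z' s J v v' s1 J1} (hL : LPair X z z' s) (hL' : LPair Y (f z) (f z') J)
    (hR : RPair X v v' s1) (hR' : RPair Y (f v) (f v') J1)
    {T} {w : Bool → List A} (hS : Str X T w) (hd : 2 * r ≤ depth w) :
    ∃ w' : Bool → List B, len w' = len w ∧ Str Y T w' ∧
      (depth w' : ℤ) = depth w + ((J - s) - (J1 - s1)) := by
  classical
  have hw : NonC w := hS.nonC ⟨z, hL.1⟩ hap
  have hne : Nonempty B := ⟨f z 0⟩
  obtain ⟨r', H, hH, hTF, hT⟩ := hS
  obtain ⟨k, hk⟩ : ∃ k : ℤ, k = r - dB w := ⟨_, rfl⟩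
  unfold depth at hd
  have hdet : ∀ x ∈ X, ∀ x' ∈ X, ∀ i i', H x i = H x' i' → f x (i + k) = f x' (i' + k) := by
    intro x hx x' hx' i i' e
    apply hr
    intro j h1 h2
    have := agree_window (hTF x hx).1 (hTF x hx).2 (hTF x' hx').1 (hTF x' hx').2 e
      (t := k + j) (by omega) (by omega)
    simpa [add_assoc] using this
  let P : Bool × ℕ → Prop := fun a => ∃ p : (ℤ → A) × ℤ, p.1 ∈ X ∧ H p.1 p.2 = a
  let val : Bool × ℕ → B := fun a => if hh : P a then f hh.choose.1 (hh.choose.2 + k)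
    else Classical.arbitrary B
  have hval : ∀ x ∈ X, ∀ i, val (H x i) = f x (i + k) := by
    intro x hx i
    have hh : P (H x i) := ⟨(x, i), hx, rfl⟩
    simp only [val, dif_pos hh]
    exact hdet _ hh.choose_spec.1 _ hx _ _ hh.choose_spec.2
  let w' : Bool → List B := fun c => List.ofFn (n := len w c) fun j => val (c, j)
  have hlen : len w' = len w := by funext c; simp [len, w']
  have hfill : ∀ x ∈ X, Fills w' (H x) (shiftBy k (f x)) := by
    intro x hx i
    have hlt := (hTF x hx).1.lt i
    simp only [w', List.getElem?_ofFn, dif_pos hlt, shiftBy]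
    rw [← hval x hx i]
  have htow : ∀ x ∈ X, Tow (len w') (H x) := fun x hx => by rw [hlen]; exact (hTF x hx).1
  have hw'  : NonC w' := by
    refine nonC_of_aperiodic (htow z hL.1) (hfill z hL.1) ?_
    rintro ⟨p, hp, hper⟩
    refine h.aper hap (f z) hL'.1 ⟨p, hp, fun i => ?_⟩
    have := hper (i - k)
    simp only [shiftBy] at this
    convert this using 2 <;> ring
  refine ⟨w', hlen, ?_, ?_⟩
  · obtain ⟨rg, hrg⟩ := h.locg
    have hXY : ∀ y ∈ Y, shiftBy (-k) y ∈ Y → g (shiftBy (-k) y) ∈ X ∧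
        shiftBy k (f (g (shiftBy (-k) y))) = y := by
      intro y hy hy'
      refine ⟨h.mapg _ hy', ?_⟩
      rw [h.fg _ hy', shiftBy_add, add_neg_cancel, shiftBy_zero]
    have hinv := h.inv hX
    refine ⟨_, H ∘ (g ∘ shiftBy (-k)), hH.comp (hrg.comp (IsLoc.shiftBy (-k))), ?_, ?_⟩
    · intro y hy
      obtain ⟨h1, h2⟩ := hXY y hy (hinv y hy _)
      refine ⟨htow _ h1, ?_⟩
      have := hfill _ h1
      rw [h2] at this
      exact this
    · rw [hT]
      ext τ
      constructor
      · rintro ⟨x, hx, rfl⟩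
        refine ⟨shiftBy k (f x), hinv _ (h.mapf x hx) k, ?_⟩
        simp only [Function.comp, shiftBy_add, neg_add_cancel, shiftBy_zero]
        rw [h.gf x hx]
      · rintro ⟨y, hy, rfl⟩
        exact ⟨_, (hXY y hy (hinv y hy _)).1, rfl⟩
  · -- left
    have key : ∀ x ∈ X, ∀ x' ∈ X, x ≠ x' → H x ≠ H x' := by
      intro x hx x' hx' hne e
      exact hne (funext fun i => fills_eq (hTF x hx).2 (hTF x' hx').2 (by rw [e]))
    have e1 : J - s = dA w' - dA w + k := by
      obtain ⟨hz, hz', h1, h2⟩ := hL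
      obtain ⟨i0, h3, h4⟩ := branch_left (key z hz z' hz' (fun e => h2 (by rw [e])))
        (a := s - r') (fun i hi => hH _ _ _ _ fun j _ _ => h1 _ (by omega))
      have a := left_branch hw (hTF z hz).1 (hTF z hz).2 (hTF z' hz').1 (hTF z' hz').2 h3 h4
      have b := left_branch hw' (htow z hz) (hfill z hz) (htow z' hz') (hfill z' hz') h3 h4
      have c1 := LPair.uniq (X := X) ⟨hz, hz', h1, h2⟩ a.1 a.2
      have c2 := hL'.uniq (s' := i0 + dA w' + k) (fun i hi => by
        have := b.1 (i - k) (by omega)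
        simpa [shiftBy] using this) (by simpa [shiftBy] using b.2)
      omega
    have e2 : J1 - s1 = dB w - dB w' + k := by
      obtain ⟨hz, hz', h1, h2⟩ := hR
      obtain ⟨i0, h3, h4⟩ := branch_right (key v hz v' hz' (fun e => h2 (by rw [e])))
        (a := s1 + r') (fun i hi => hH _ _ _ _ fun j _ _ => h1 _ (by omega))
      have a := right_branch hw (hTF v hz).1 (hTF v hz).2 (hTF v' hz').1 (hTF v' hz').2 h3 h4
      have b := right_branch hw' (htow v hz) (hfill v hz) (htow v' hz') (hfill v' hz') h3 h4
      have c1 := RPair.uniq (X := X) ⟨hz, hz', h1, h2⟩ a.1 a.2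
      have c2 := hR'.uniq (s' := i0 - dB w' + k) (fun i hi => by
        have := b.1 (i - k) (by omega)
        simpa [shiftBy] using this) (by simpa [shiftBy] using b.2)
      omega
    unfold depth
    push_cast
    omega

/-! ### The invariants `TT n X` -/

def TT (n : ℕ) (X : Set (ℤ → A)) : Set (Set (ℤ → Bool × ℕ)) :=
  {T | ∃ w, Str X T w ∧ tlen w ≤ n ∧ ∀ T' w', Str X T' w' → tlen w' ≤ n → depth w' ≤ depth w}

def Deep (X : Set (ℤ → A)) : Prop := ∀ d : ℕ, ∃ T w, Str X T w ∧ d ≤ depth w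

def Trans (D : ℕ) (e : ℤ) (X : Set (ℤ → A)) (Y : Set (ℤ → B)) : Prop :=
  ∀ T w, Str X T w → D ≤ depth w →
    ∃ w', len w' = len w ∧ Str Y T w' ∧ (depth w' : ℤ) = depth w + e

lemma exists_trans [TopologicalSpace A] [DiscreteTopology A]
    {X : Set (ℤ → A)} {Y : Set (ℤ → B)} {f g} (h : LConj X Y f g)
    (hc : IsCompact X) (hX : Inv X) (hne : X.Nonempty)
    (hap : ∀ x ∈ X, IsAperiodicPoint x) : ∃ D e, Trans D e X Y ∧ Trans D (-e) Y X := by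
  obtain ⟨z, z', s, hL⟩ := exists_LPair hc hX hne hap
  obtain ⟨v, v', s1, hR⟩ := exists_RPair hc hX hne hap
  obtain ⟨J, hL'⟩ := LPair.map h hL
  obtain ⟨J1, hR'⟩ := RPair.map h hR
  obtain ⟨r, hr⟩ := h.locf
  obtain ⟨r', hr'⟩ := h.locg
  refine ⟨2 * r + 2 * r', (J - s) - (J1 - s1), ?_, ?_⟩
  · intro T w hS hd
    exact transfer h hr hX hap hL hL' hR hR' hS (by omega)
  · intro T w hS hd
    have hL2 : LPair X (g (f z)) (g (f z')) s := by
      rw [h.gf z hL.1, h.gf z' hL.2.1]; exact hL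
    have hR2 : RPair X (g (f v)) (g (f v')) s1 := by
      rw [h.gf v hR.1, h.gf v' hR.2.1]; exact hR
    obtain ⟨w', h1, h2, h3⟩ := transfer h.symm hr' (h.inv hX) (h.aper hap) hL' hL2 hR' hR2 hS
      (by omega)
    exact ⟨w', h1, h2, by rw [h3]; ring⟩

lemma Deep.trans {X : Set (ℤ → A)} {Y : Set (ℤ → B)} {D e} (h : Trans D e X Y) (hd : Deep X) :
    Deep Y := by
  intro d
  obtain ⟨T, w, hS, hw⟩ := hd (D + d + e.natAbs)
  obtain ⟨w', h1, h2, h3⟩ := h T w hS (by omega)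
  exact ⟨T, w', h2, by omega⟩

lemma TT_sub {X : Set (ℤ → A)} {Y : Set (ℤ → B)} {D e} (h1 : Trans D e X Y)
    (h2 : Trans D (-e) Y X) {n T0} {w0 : Bool → List A} (hS0 : Str X T0 w0) (hn : tlen w0 ≤ n)
    (hd : D + e.natAbs ≤ depth w0) : TT n X ⊆ TT n Y := by
  rintro T ⟨w, hS, hwn, hmax⟩
  have hd0 := hmax T0 w0 hS0 hn
  obtain ⟨w', a1, a2, a3⟩ := h1 T w hS (by omega)
  refine ⟨w', a2, by rw [tlen_eq a1]; exact hwn, ?_⟩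
  intro T'' w'' hS'' hn''
  by_contra hlt
  push Not at hlt
  obtain ⟨v, b1, b2, b3⟩ := h2 T'' w'' hS'' (by omega)
  have := hmax T'' v b2 (by rw [tlen_eq b1]; exact hn'')
  omega

lemma TT_nonempty {X : Set (ℤ → A)} {n T0} {w0 : Bool → List A} (hS0 : Str X T0 w0)
    (hn : tlen w0 ≤ n) : (TT n X).Nonempty := by
  classical
  let P : ℕ → Prop := fun d => ∃ T w, Str X T w ∧ tlen w ≤ n ∧ depth w = d
  have hP : P (depth w0) := ⟨T0, w0, hS0, hn, rfl⟩
  have hb : ∀ d, P d → d ≤ 2 * n := by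
    rintro d ⟨T, w, -, h1, rfl⟩
    have := depth_le w; omega
  have hspec := Nat.findGreatest_spec (hb _ hP) hP
  obtain ⟨T, w, h1, h2, h3⟩ := hspec
  refine ⟨T, w, h1, h2, fun T' w' h1' h2' => ?_⟩
  rw [h3]
  have hP' : P (depth w') := ⟨T', w', h1', h2', rfl⟩
  exact Nat.le_findGreatest (hb _ hP') hP'

lemma TT_eventually [TopologicalSpace A] [DiscreteTopology A]
    {X : Set (ℤ → A)} {Y : Set (ℤ → B)} {f g} (h : LConj X Y f g)
    (hc : IsCompact X) (hX : Inv X) (hne : X.Nonempty)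
    (hap : ∀ x ∈ X, IsAperiodicPoint x) (hdeep : Deep X) :
    ∃ N, ∀ n ≥ N, TT n X = TT n Y ∧ (TT n X).Nonempty := by
  obtain ⟨D, e, h1, h2⟩ := exists_trans h hc hX hne hap
  obtain ⟨T0, w0, hS0, hd0⟩ := hdeep (D + 2 * e.natAbs)
  obtain ⟨w0', a1, a2, a3⟩ := h1 T0 w0 hS0 (by omega)
  refine ⟨tlen w0, fun n hn => ⟨subset_antisymm ?_ ?_, TT_nonempty hS0 hn⟩⟩
  · exact TT_sub h1 h2 hS0 hn (by omega)
  · refine TT_sub h2 (by rwa [neg_neg]) a2 (by rw [tlen_eq a1]; exact hn) ?_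
    rw [Int.natAbs_neg]; omega

lemma lconj_of_str {X : Set (ℤ → A)} {Y : Set (ℤ → B)} {T w w'} (h : Str X T w)
    (h' : Str Y T w') (hne : X.Nonempty) (hneY : Y.Nonempty) : ∃ f g, LConj X Y f g := by
  classical
  obtain ⟨r, H, hH, hTF, hT⟩ := h
  obtain ⟨r', H', hH', hTF', hT'⟩ := h'
  obtain ⟨x0, hx0⟩ := hne
  obtain ⟨y0, hy0⟩ := hneY
  let F : (ℤ → Bool × ℕ) → (ℤ → B) := fun τ i => ((w' (τ i).1)[(τ i).2]?).getD (y0 0)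
  let G : (ℤ → Bool × ℕ) → (ℤ → A) := fun τ i => ((w (τ i).1)[(τ i).2]?).getD (x0 0)
  have lF : IsLoc 0 F := by
    intro x y i i' hh
    have := hh 0 (by simp) (by simp)
    simp only [add_zero] at this
    simp only [F, this]
  have lG : IsLoc 0 G := by
    intro x y i i' hh
    have := hh 0 (by simp) (by simp)
    simp only [add_zero] at this
    simp only [G, this]
  have fF : ∀ y ∈ Y, F (H' y) = y := by
    intro y hy; funext i
    simp only [F]; rw [(hTF' y hy).2 i]; rfl
  have fG : ∀ x ∈ X, G (H x) = x := by
    intro x hx; funext i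
    simp only [G]; rw [(hTF x hx).2 i]; rfl
  have XY : ∀ x ∈ X, ∃ y ∈ Y, H' y = H x := by
    intro x hx
    have : H x ∈ T := by rw [hT]; exact ⟨x, hx, rfl⟩
    rw [hT'] at this; exact this
  have YX : ∀ y ∈ Y, ∃ x ∈ X, H x = H' y := by
    intro y hy
    have : H' y ∈ T := by rw [hT']; exact ⟨y, hy, rfl⟩
    rw [hT] at this; exact this
  refine ⟨F ∘ H, G ∘ H', ⟨_, lF.comp hH⟩, ⟨_, lG.comp hH'⟩, ?_, ?_, ?_, ?_⟩
  · intro x hx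
    obtain ⟨y, hy, e⟩ := XY x hx
    simp only [Function.comp]; rw [← e, fF y hy]; exact hy
  · intro y hy
    obtain ⟨x, hx, e⟩ := YX y hy
    simp only [Function.comp]; rw [← e, fG x hx]; exact hx
  · intro x hx
    obtain ⟨y, hy, e⟩ := XY x hx
    simp only [Function.comp]; rw [← e, fF y hy, e, fG x hx]
  · intro y hy
    obtain ⟨x, hx, e⟩ := YX y hy
    simp only [Function.comp]; rw [← e, fG x hx, e, fF y hy]

lemma Str.carrier_eq {X : Set (ℤ → A)} {T w} (h : Str X T w) :
    X = {x | ∃ τ ∈ T, Fills w τ x} := by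
  obtain ⟨r, H, hH, hTF, rfl⟩ := h
  ext x
  constructor
  · intro hx; exact ⟨H x, ⟨x, hx, rfl⟩, (hTF x hx).2⟩
  · rintro ⟨_, ⟨y, hy, rfl⟩, hf⟩
    have : x = y := funext fun i => fills_eq hf (hTF y hy).2 rfl
    rwa [this]

/-! ### Languages -/

lemma factorAt_def (x : ℤ → A) (i : ℤ) (n : ℕ) :
    factorAt x i n = (List.range n).map (fun j : ℕ => x (i + (j : ℤ))) := by
  unfold factorAt
  induction n with
  | zero => simp
  | succ n ih => simp_all [List.range_succ]

lemma factorAt_eq_iff {x y : ℤ → A} {i i' : ℤ} {n : ℕ} :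
    factorAt x i n = factorAt y i' n ↔ ∀ j : ℕ, j < n → x (i + j) = y (i' + j) := by
  simp [factorAt_def]

lemma lang_pick {X X' : Set (ℤ → A)} (hX : Inv X) {n : ℕ} (h : Lang n X' ⊆ Lang n X)
    {x' : ℤ → A} (hx' : x' ∈ X') (a : ℤ) :
    ∃ x ∈ X, ∀ i, a ≤ i → i < a + n → x i = x' i := by
  obtain ⟨x0, hx0, i0, e⟩ := h ⟨x', hx', a, rfl⟩
  rw [factorAt_eq_iff] at e
  refine ⟨shiftBy (i0 - a) x0, hX x0 hx0 _, fun i h1 h2 => ?_⟩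
  have := e (i - a).toNat (by omega)
  rw [Int.toNat_of_nonneg (by omega)] at this
  simp only [shiftBy]
  rw [eq_comm]
  convert this using 2 <;> ring

lemma lang_finite [TopologicalSpace A] [DiscreteTopology A] {X : Set (ℤ → A)}
    (hc : IsCompact X) (hX : Inv X) (n : ℕ) : (Lang n X).Finite := by
  have h1 : IsCompact ((fun y : ℤ → A => fun j : Fin n => y (j : ℕ)) '' X) :=
    hc.image (continuous_pi fun j => continuous_apply _)
  refine ((isCompact_iff_finite.mp h1).image List.ofFn).subset ?_
  rintro _ ⟨x, hx, i, rfl⟩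
  refine ⟨_, ⟨shiftBy i x, hX x hx i, rfl⟩, ?_⟩
  apply List.ext_getElem
  · simp [factorAt_def]
  · intro j h1 h2
    simp [factorAt_def, shiftBy, add_comm]

lemma sub_of_lang [TopologicalSpace A] [DiscreteTopology A] {X Y : Set (ℤ → A)}
    (hY : Inv Y) (hc : IsCompact Y) (h : ∀ n, Lang n X ⊆ Lang n Y) : X ⊆ Y := by
  intro x hx
  rw [← hc.isClosed.closure_eq, mem_closure_iff]
  intro U hU hxU
  obtain ⟨I, u, hu, hsub⟩ := isOpen_pi_iff.mp hU x hxU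
  obtain ⟨m, hm⟩ : ∃ m : ℕ, ∀ i ∈ I, i.natAbs ≤ m :=
    ⟨I.sup Int.natAbs, fun i hi => Finset.le_sup (f := Int.natAbs) hi⟩
  obtain ⟨y, hy, hxy⟩ := lang_pick hY (h (2 * m + 1)) hx (-m)
  refine ⟨y, hsub ?_, hy⟩
  intro i hi
  have := hm i hi
  rw [hxy i (by omega) (by push_cast; omega)]
  exact (hu i hi).2

lemma eq_of_lang [TopologicalSpace A] [DiscreteTopology A] {X Y : Set (ℤ → A)}
    (hX : Inv X) (hcX : IsCompact X) (hY : Inv Y) (hc : IsCompact Y)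
    (h : ∀ n, Lang n X = Lang n Y) : X = Y :=
  subset_antisymm (sub_of_lang hY hc fun n => (h n).subset)
    (sub_of_lang hX hcX fun n => (h n).superset)

lemma SubshiftSpace.inv (X : SubshiftSpace) : Inv X.carrier := inv_of_shift X.invariant

lemma SubshiftSpace.ext' {X Y : SubshiftSpace} (h : X.carrier = Y.carrier) : X = Y := by
  cases X; cases Y; simp at h; subst h; rfl

/-! ### Codes -/

abbrev Code : Type := ℕ × (List ℤ →₀ ℕ)

noncomputable def mapC (γ : Code) (x : ℤ → ℤ) : ℤ → Bool × ℕ := fun i =>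
  ((Encodable.decode (γ.2 (factorAt x (i - γ.1) (2 * γ.1 + 1))) : Option (Bool × ℕ))).getD
    (false, 0)

lemma mapC_loc (γ : Code) : IsLoc γ.1 (mapC γ) := by
  intro x y i i' h
  unfold mapC
  have : factorAt x (i - γ.1) (2 * γ.1 + 1) = factorAt y (i' - γ.1) (2 * γ.1 + 1) := by
    rw [factorAt_eq_iff]
    intro j hj
    have := h (j - γ.1) (by omega) (by omega)
    convert this using 2 <;> ring
  rw [this]

lemma code_exists {X : Set (ℤ → ℤ)} (hc : IsCompact X) (hX : Inv X) {r : ℕ}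
    {h : (ℤ → ℤ) → (ℤ → Bool × ℕ)} (hh : IsLoc r h) : ∃ γ, ∀ x ∈ X, mapC γ x = h x := by
  classical
  let P : List ℤ → (ℤ → ℤ) × ℤ → Prop := fun l p => l = factorAt p.1 (p.2 - r) (2 * r + 1)
  let c : List ℤ → ℕ := fun l => if hl : ∃ p, P l p then
    Encodable.encode (h hl.choose.1 hl.choose.2) else 0
  refine ⟨(r, Finsupp.indicator (lang_finite hc hX (2 * r + 1)).toFinset fun l _ => c l), ?_⟩
  intro x hx
  funext i
  unfold mapC
  simp only
  rw [Finsupp.indicator_of_mem (by simp only [Set.Finite.mem_toFinset]; exact ⟨x, hx, _, rfl⟩)]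
  have hl : ∃ p, P (factorAt x (i - r) (2 * r + 1)) p := ⟨(x, i), rfl⟩
  simp only [c, dif_pos hl, Encodable.encodek, Option.getD_some]
  have := hl.choose_spec
  simp only [P] at this
  rw [factorAt_eq_iff] at this
  apply hh
  intro j h1 h2
  have := this (j + r).toNat (by omega)
  rw [Int.toNat_of_nonneg (by omega)] at this
  rw [eq_comm]
  convert this using 2 <;> ring

def SC (X : Set (ℤ → ℤ)) (γ : Code) (w : Bool → List ℤ) : Prop :=
  ∀ x ∈ X, Adj (len w) (mapC γ x 0) (mapC γ x 1) ∧
    (w (mapC γ x 0).1)[(mapC γ x 0).2]? = some (x 0)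

lemma str_of_SC {X : Set (ℤ → ℤ)} (hX : Inv X) {γ w} (h : SC X γ w) :
    Str X (mapC γ '' X) w := by
  refine ⟨_, mapC γ, mapC_loc γ, fun x hx => ⟨fun i => ?_, fun i => ?_⟩, rfl⟩
  · have := (h _ (hX x hx i)).1
    rw [(mapC_loc γ).shift_comm] at this
    simpa [shiftBy, add_comm] using this
  · have := (h _ (hX x hx i)).2
    rw [(mapC_loc γ).shift_comm] at this
    simpa [shiftBy, add_comm] using this

lemma SC_of_str {X : Set (ℤ → ℤ)} (hc : IsCompact X) (hX : Inv X) {T w} (h : Str X T w) :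
    ∃ γ, SC X γ w ∧ T = mapC γ '' X := by
  obtain ⟨r, H, hH, hTF, rfl⟩ := h
  obtain ⟨γ, hγ⟩ := code_exists hc hX hH
  refine ⟨γ, fun x hx => ?_, ?_⟩
  · rw [hγ x hx]
    refine ⟨?_, (hTF x hx).2 0⟩
    have := (hTF x hx).1 0
    simpa using this
  · exact (Set.image_congr hγ).symm

def MC (n : ℕ) (X : Set (ℤ → ℤ)) (γ : Code) (w : Bool → List ℤ) : Prop :=
  SC X γ w ∧ tlen w ≤ n ∧ ∀ (γ' : Code) (w' : Bool → List ℤ), SC X γ' w' → tlen w' ≤ n →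
    depth w' ≤ depth w

lemma mem_TT_iff {X : Set (ℤ → ℤ)} (hc : IsCompact X) (hX : Inv X) {n T} :
    T ∈ TT n X ↔ ∃ γ w, MC n X γ w ∧ T = mapC γ '' X := by
  constructor
  · rintro ⟨w, h1, h2, h3⟩
    obtain ⟨γ, hγ, hT⟩ := SC_of_str hc hX h1
    exact ⟨γ, w, ⟨hγ, h2, fun γ' w' h1' h2' => h3 _ w' (str_of_SC hX h1') h2'⟩, hT⟩
  · rintro ⟨γ, w, ⟨h1, h2, h3⟩, rfl⟩
    refine ⟨w, str_of_SC hX h1, h2, fun T' w' h1' h2' => ?_⟩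
    obtain ⟨γ', hγ', -⟩ := SC_of_str hc hX h1'
    exact h3 γ' w' hγ' h2'

/-! ### Borel computations -/

instance instBorelPair : MeasurableSpace (SubshiftSpace × SubshiftSpace) :=
  borel (SubshiftSpace × SubshiftSpace)

lemma atom_measurable {P : SubshiftSpace × SubshiftSpace → Prop} (M N : ℕ)
    (h : ∀ p q : SubshiftSpace × SubshiftSpace, Lang M p.1.carrier = Lang M q.1.carrier →
      Lang N p.2.carrier = Lang N q.2.carrier → P p → P q) : Measurable P := by
  rw [← measurableSet_setOf]
  apply MeasurableSpace.measurableSet_generateFrom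
  show IsOpen {p : SubshiftSpace × SubshiftSpace | P p}
  have hl : ∀ (n : ℕ) (S : Set (List ℤ)), IsOpen {X : SubshiftSpace | Lang n X.carrier = S} := by
    intro n S
    letI : TopologicalSpace (Set (List ℤ)) := ⊥
    have : DiscreteTopology (Set (List ℤ)) := ⟨rfl⟩
    refine isOpen_induced_iff.mpr ⟨{f : ℕ → Set (List ℤ) | f n = S}, ?_, rfl⟩
    exact (isOpen_discrete {S}).preimage (continuous_apply (A := fun _ : ℕ => Set (List ℤ)) n)
  rw [isOpen_iff_forall_mem_open]
  intro p hp
  refine ⟨{X : SubshiftSpace | Lang M X.carrier = Lang M p.1.carrier} ×ˢ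
    {X : SubshiftSpace | Lang N X.carrier = Lang N p.2.carrier}, ?_, (hl _ _).prod (hl _ _), ⟨rfl, rfl⟩⟩
  rintro q ⟨h1, h2⟩
  exact h p q h1.symm h2.symm hp

lemma SC_det {X X' : Set (ℤ → ℤ)} (hX : Inv X) {γ : Code} {w}
    (h : Lang (2 * γ.1 + 2) X' ⊆ Lang (2 * γ.1 + 2) X) (hS : SC X γ w) : SC X' γ w := by
  intro x' hx'
  obtain ⟨x, hx, e⟩ := lang_pick hX h hx' (-γ.1)
  have h0 : mapC γ x' 0 = mapC γ x 0 := mapC_loc γ _ _ _ _ fun j h1 h2 =>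
    (e _ (by omega) (by push_cast; omega)).symm
  have h1 : mapC γ x' 1 = mapC γ x 1 := mapC_loc γ _ _ _ _ fun j h1 h2 =>
    (e _ (by omega) (by push_cast; omega)).symm
  rw [h0, h1, ← e 0 (by omega) (by push_cast; omega)]
  exact hS x hx

lemma SC_meas (γ : Code) (w : Bool → List ℤ) :
    Measurable (fun p : SubshiftSpace × SubshiftSpace => SC p.1.carrier γ w) ∧
    Measurable (fun p : SubshiftSpace × SubshiftSpace => SC p.2.carrier γ w) := by
  constructor
  · refine atom_measurable (2 * γ.1 + 2) 0 fun p q h _ => SC_det p.1.inv h.superset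
  · refine atom_measurable 0 (2 * γ.1 + 2) fun p q _ h => SC_det p.2.inv h.superset

lemma MC_meas (n : ℕ) (γ : Code) (w : Bool → List ℤ) :
    Measurable (fun p : SubshiftSpace × SubshiftSpace => MC n p.1.carrier γ w) ∧
    Measurable (fun p : SubshiftSpace × SubshiftSpace => MC n p.2.carrier γ w) := by
  unfold MC
  constructor
  · refine (SC_meas γ w).1.and (measurable_const.and ?_)
    refine Measurable.forall fun γ' => Measurable.forall fun w' => ?_
    exact (SC_meas γ' w').1.imp measurable_const
  · refine (SC_meas γ w).2.and (measurable_const.and ?_)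
    refine Measurable.forall fun γ' => Measurable.forall fun w' => ?_
    exact (SC_meas γ' w').2.imp measurable_const

lemma lang_image_sub {X X' : Set (ℤ → ℤ)} (hX : Inv X) {γ : Code} {m : ℕ}
    (h : Lang (m + 2 * γ.1) X' ⊆ Lang (m + 2 * γ.1) X) :
    Lang m (mapC γ '' X') ⊆ Lang m (mapC γ '' X) := by
  rintro _ ⟨_, ⟨x', hx', rfl⟩, i, rfl⟩
  obtain ⟨x, hx, e⟩ := lang_pick hX h hx' (i - γ.1)
  refine ⟨_, ⟨x, hx, rfl⟩, i, ?_⟩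
  rw [factorAt_eq_iff]
  intro j hj
  refine mapC_loc γ _ _ _ _ fun t h1 h2 => (e _ (by omega) (by push_cast; omega)).symm

lemma image_inv {X : Set (ℤ → A)} (hX : Inv X) {r : ℕ} {h : (ℤ → A) → (ℤ → B)}
    (hh : IsLoc r h) : Inv (h '' X) := by
  rintro _ ⟨x, hx, rfl⟩ k
  exact ⟨_, hX x hx k, hh.shift_comm k x⟩

lemma I_meas (γ γ' : Code) : Measurable (fun p : SubshiftSpace × SubshiftSpace =>
    mapC γ '' p.1.carrier = mapC γ' '' p.2.carrier) := by
  have : (fun p : SubshiftSpace × SubshiftSpace =>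
      mapC γ '' p.1.carrier = mapC γ' '' p.2.carrier) = fun p => ∀ m,
      Lang m (mapC γ '' p.1.carrier) = Lang m (mapC γ' '' p.2.carrier) := by
    funext p
    apply propext
    constructor
    · intro h m; rw [h]
    · intro h
      exact eq_of_lang (image_inv p.1.inv (mapC_loc γ))
        (p.1.compact.image (mapC_loc γ).continuous) (image_inv p.2.inv (mapC_loc γ'))
        (p.2.compact.image (mapC_loc γ').continuous) h
  rw [this]
  refine Measurable.forall fun m => atom_measurable (m + 2 * γ.1) (m + 2 * γ'.1) ?_
  intro p q h1 h2 h
  rw [← subset_antisymm (lang_image_sub q.1.inv h1.subset) (lang_image_sub p.1.inv h1.superset),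
    ← subset_antisymm (lang_image_sub q.2.inv h2.subset) (lang_image_sub p.2.inv h2.superset), h]

lemma TT_eq_meas (n : ℕ) : Measurable (fun p : SubshiftSpace × SubshiftSpace =>
    TT n p.1.carrier = TT n p.2.carrier) := by
  have : (fun p : SubshiftSpace × SubshiftSpace =>
      TT n p.1.carrier = TT n p.2.carrier) = fun p =>
      (∀ (γ : Code) (w : Bool → List ℤ), MC n p.1.carrier γ w →
        ∃ (γ' : Code) (w' : Bool → List ℤ), MC n p.2.carrier γ' w' ∧
          mapC γ '' p.1.carrier = mapC γ' '' p.2.carrier) ∧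
      (∀ (γ' : Code) (w' : Bool → List ℤ), MC n p.2.carrier γ' w' →
        ∃ (γ : Code) (w : Bool → List ℤ), MC n p.1.carrier γ w ∧
          mapC γ '' p.1.carrier = mapC γ' '' p.2.carrier) := by
    funext p
    apply propext
    have k1 := fun T => mem_TT_iff (T := T) (n := n) p.1.compact p.1.inv
    have k2 := fun T => mem_TT_iff (T := T) (n := n) p.2.compact p.2.inv
    constructor
    · intro h
      constructor
      · intro γ w hM
        have h1 := (k1 (mapC γ '' p.1.carrier)).2 ⟨γ, w, hM, rfl⟩
        rw [h] at h1
        exact (k2 _).1 h1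
      · intro γ w hM
        have h1 := (k2 (mapC γ '' p.2.carrier)).2 ⟨γ, w, hM, rfl⟩
        rw [← h] at h1
        obtain ⟨γ', w', a, b⟩ := (k1 _).1 h1
        exact ⟨γ', w', a, b.symm⟩
    · rintro ⟨h1, h2⟩
      ext T
      rw [k1, k2]
      constructor
      · rintro ⟨γ, w, hM, rfl⟩
        exact h1 γ w hM
      · rintro ⟨γ, w, hM, rfl⟩
        obtain ⟨γ', w', a, b⟩ := h2 γ w hM
        exact ⟨γ', w', a, b.symm⟩
  rw [this]
  refine Measurable.and ?_ ?_
  · refine Measurable.forall fun γ => Measurable.forall fun w => Measurable.imp (MC_meas n γ w).1 ?_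
    refine Measurable.exists fun γ' => Measurable.exists fun w' => ?_
    exact (MC_meas n γ' w').2.and (I_meas γ γ')
  · refine Measurable.forall fun γ => Measurable.forall fun w => Measurable.imp (MC_meas n γ w).2 ?_
    refine Measurable.exists fun γ' => Measurable.exists fun w' => ?_
    exact (MC_meas n γ' w').1.and (I_meas γ' γ)

lemma TT_ne_meas (n : ℕ) : Measurable (fun p : SubshiftSpace × SubshiftSpace =>
    (TT n p.1.carrier).Nonempty) := by
  have : (fun p : SubshiftSpace × SubshiftSpace => (TT n p.1.carrier).Nonempty) = fun p =>
      ∃ (γ : Code) (w : Bool → List ℤ), MC n p.1.carrier γ w := by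
    funext p
    apply propext
    have k1 := fun T => mem_TT_iff (T := T) (n := n) p.1.compact p.1.inv
    constructor
    · rintro ⟨T, hT⟩
      obtain ⟨γ, w, h, -⟩ := (k1 T).1 hT
      exact ⟨γ, w, h⟩
    · rintro ⟨γ, w, h⟩
      exact ⟨_, (k1 _).2 ⟨γ, w, h, rfl⟩⟩
  rw [this]
  exact Measurable.exists fun γ => Measurable.exists fun w => (MC_meas n γ w).1

lemma diag_meas : Measurable (fun p : SubshiftSpace × SubshiftSpace => p.1 = p.2) := by
  have : (fun p : SubshiftSpace × SubshiftSpace => p.1 = p.2) = fun p =>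
      ∀ n, Lang n p.1.carrier = Lang n p.2.carrier := by
    funext p
    apply propext
    constructor
    · intro h n; rw [h]
    · intro h
      exact SubshiftSpace.ext' (eq_of_lang p.1.inv p.1.compact p.2.inv p.2.compact h)
  rw [this]
  refine Measurable.forall fun n => atom_measurable n n ?_
  intro p q h1 h2 h
  rw [← h1, ← h2, h]

def Bd (k : ℕ) (X : Set (ℤ → ℤ)) : Prop := ∀ x ∈ X, ∀ i, -(k : ℤ) ≤ x i ∧ x i ≤ k

lemma Bd_det {k : ℕ} {X X' : Set (ℤ → ℤ)} (hX : Inv X) (h : Lang 1 X' ⊆ Lang 1 X)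
    (hb : Bd k X) : Bd k X' := by
  intro x' hx' i
  obtain ⟨x, hx, e⟩ := lang_pick hX h hx' i
  rw [← e i le_rfl (by simp)]
  exact hb x hx i

lemma Bd_meas (k : ℕ) : Measurable (fun p : SubshiftSpace × SubshiftSpace => Bd k p.1.carrier) ∧
    Measurable (fun p : SubshiftSpace × SubshiftSpace => Bd k p.2.carrier) :=
  ⟨atom_measurable 1 0 fun p _ h _ => Bd_det p.1.inv h.superset,
    atom_measurable 0 1 fun p _ _ h => Bd_det p.2.inv h.superset⟩

lemma exists_Bd (X : SubshiftSpace) : ∃ k, Bd k X.carrier := by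
  obtain ⟨m, hm⟩ : ∃ m : ℕ, ∀ a ∈ (fun x : ℤ → ℤ => x 0) '' X.carrier, a.natAbs ≤ m := by
    have hf := isCompact_iff_finite.mp (X.compact.image (continuous_apply (0 : ℤ)))
    exact ⟨hf.toFinset.sup Int.natAbs, fun i hi =>
      Finset.le_sup (f := Int.natAbs) (hf.mem_toFinset.mpr hi)⟩
  refine ⟨m, fun x hx i => ?_⟩
  have := hm (x i) ⟨shiftBy i x, X.inv x hx i, by simp [shiftBy]⟩
  omega

lemma Bd.mono {k l : ℕ} {X : Set (ℤ → ℤ)} (h : Bd k X) (hkl : k ≤ l) : Bd l X :=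
  fun x hx i => ⟨by have := (h x hx i).1; omega, by have := (h x hx i).2; omega⟩

/-! ### The finite relations -/

def Rel (k : ℕ) (p : SubshiftSpace × SubshiftSpace) : Prop :=
  p.1 = p.2 ∨ (Bd k p.1.carrier ∧ Bd k p.2.carrier ∧
    ∀ n, k ≤ n → TT n p.1.carrier = TT n p.2.carrier ∧ (TT n p.1.carrier).Nonempty)

lemma Rel_meas (k : ℕ) : Measurable (Rel k) := by
  unfold Rel
  refine diag_meas.or ((Bd_meas k).1.and ((Bd_meas k).2.and ?_))
  refine Measurable.forall fun n => Measurable.imp measurable_const ?_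
  exact (TT_eq_meas n).and (TT_ne_meas n)

lemma finite_TT (k : ℕ) (T : Set (ℤ → Bool × ℕ)) :
    {Y : SubshiftSpace | Bd k Y.carrier ∧ T ∈ TT k Y.carrier}.Finite := by
  classical
  let dec : Fin (2 * k + 1) → ℤ := fun a => (a : ℕ) - (k : ℤ)
  let enc : ℤ → Fin (2 * k + 1) := fun a => Fin.ofNat (2 * k + 1) (a + k).toNat
  have hde : ∀ a : ℤ, -(k : ℤ) ≤ a → a ≤ k → dec (enc a) = a := by
    intro a h1 h2
    simp only [dec, enc, Fin.val_ofNat]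
    rw [Nat.mod_eq_of_lt (by omega)]
    omega
  let W : Set (Bool → List (Fin (2 * k + 1))) := {v | ∀ c, v c ∈ {l | l.length ≤ k}}
  have hW : W.Finite := Set.Finite.pi' fun _ => List.finite_length_le _ k
  let S : (Bool → List (Fin (2 * k + 1))) → Set (ℤ → ℤ) := fun v =>
    {y | ∃ τ ∈ T, Fills (fun c => (v c).map dec) τ y}
  refine Set.Finite.subset (hW.biUnion (t := fun v => {Y : SubshiftSpace | Y.carrier = S v})
    fun v _ => Set.Subsingleton.finite fun Y hY Z hZ => SubshiftSpace.ext' (hY.trans hZ.symm)) ?_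
  rintro Y ⟨hb, w, hS, hl, -⟩
  rw [Set.mem_iUnion₂]
  refine ⟨fun c => (w c).map enc, ?_, ?_⟩
  · intro c
    simp only [Set.mem_setOf_eq, List.length_map]
    unfold tlen at hl
    cases c <;> omega
  · have : Str Y.carrier T (fun c => ((w c).map enc).map dec) := by
      obtain ⟨r, H, hH, hTF, hT⟩ := hS
      refine ⟨r, H, hH, fun x hx => ⟨?_, fun i => ?_⟩, hT⟩
      · have e : len (fun c => ((w c).map enc).map dec) = len w := by
          funext c; simp [len]
        rw [e]; exact (hTF x hx).1
      · simp only [List.getElem?_map]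
        rw [(hTF x hx).2 i]
        simp [hde _ (hb x hx i).1 (hb x hx i).2]
    exact this.carrier_eq

theorem main_of_deep (hdeep : ∀ X ∈ T2Set, Deep X.carrier) :
    ∃ F : ℕ → Set (SubshiftSpace × SubshiftSpace),
      (∀ k, F k ⊆ T2Set ×ˢ T2Set) ∧
      (∀ k, ∀ X ∈ T2Set, (X, X) ∈ F k) ∧
      (∀ k X Y, (X, Y) ∈ F k → (Y, X) ∈ F k) ∧
      (∀ k X Y Z, (X, Y) ∈ F k → (Y, Z) ∈ F k → (X, Z) ∈ F k) ∧
      (∀ k X, {Y | (X, Y) ∈ F k}.Finite) ∧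
      (∀ k, ∃ Bk : Set (SubshiftSpace × SubshiftSpace),
        @MeasurableSet _ (borel (SubshiftSpace × SubshiftSpace)) Bk ∧
        F k = Bk ∩ T2Set ×ˢ T2Set) ∧
      (∀ k, F k ⊆ F (k+1)) ∧
      (⋃ k, F k) = {p : SubshiftSpace × SubshiftSpace |
        p.1 ∈ T2Set ∧ p.2 ∈ T2Set ∧ Conjugate p.1.carrier p.2.carrier} := by
  refine ⟨fun k => {p | Rel k p} ∩ T2Set ×ˢ T2Set, fun k => Set.inter_subset_right,
    fun k X hX => ⟨Or.inl rfl, hX, hX⟩, ?_, ?_, ?_, ?_, ?_, ?_⟩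
  · rintro k X Y ⟨h, hX, hY⟩
    refine ⟨?_, hY, hX⟩
    rcases h with h | ⟨h1, h2, h3⟩
    · exact Or.inl h.symm
    · refine Or.inr ⟨h2, h1, fun n hn => ⟨(h3 n hn).1.symm, ?_⟩⟩
      simp only
      rw [← (h3 n hn).1]; exact (h3 n hn).2
  · rintro k X Y Z ⟨h, hX, hY⟩ ⟨h', -, hZ⟩
    refine ⟨?_, hX, hZ⟩
    rcases h with h | ⟨h1, h2, h3⟩
    · simp only at h; subst h; exact h'
    · rcases h' with h' | ⟨h1', h2', h3'⟩
      · simp only at h'; subst h'; exact Or.inr ⟨h1, h2, h3⟩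
      · exact Or.inr ⟨h1, h2', fun n hn => ⟨(h3 n hn).1.trans (h3' n hn).1, (h3 n hn).2⟩⟩
  · intro k X
    by_cases hne : (TT k X.carrier).Nonempty
    · obtain ⟨T, hT⟩ := hne
      refine Set.Finite.subset ((Set.finite_singleton X).union (finite_TT k T)) ?_
      rintro Y ⟨h | ⟨h1, h2, h3⟩, -⟩
      · exact Or.inl h.symm
      · refine Or.inr ⟨h2, ?_⟩
        have := (h3 k le_rfl).1
        simp only at this
        rwa [← this]
    · refine Set.Finite.subset (Set.finite_singleton X) ?_
      rintro Y ⟨h | ⟨h1, h2, h3⟩, -⟩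
      · exact h.symm
      · exact absurd (h3 k le_rfl).2 hne
  · intro k
    exact ⟨{p | Rel k p}, measurableSet_setOf.mpr (Rel_meas k), rfl⟩
  · rintro k p ⟨h, hp⟩
    refine ⟨?_, hp⟩
    rcases h with h | ⟨h1, h2, h3⟩
    · exact Or.inl h
    · exact Or.inr ⟨h1.mono (by omega), h2.mono (by omega), fun n hn => h3 n (by omega)⟩
  · ext ⟨X, Y⟩
    rw [Set.mem_iUnion]
    constructor
    · rintro ⟨k, h, hX, hY⟩
      refine ⟨hX, hY, ?_⟩
      rcases h with h | ⟨h1, h2, h3⟩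
      · simp only at h; subst h
        exact ⟨Homeomorph.refl _, fun x hx hx' => rfl⟩
      · obtain ⟨h4, T, hT⟩ := h3 k le_rfl
        have hT' := hT
        rw [h4] at hT'
        obtain ⟨w, hS, -⟩ := hT
        obtain ⟨w', hS', -⟩ := hT'
        obtain ⟨f, g, hfg⟩ := lconj_of_str hS hS' X.nonempty Y.nonempty
        exact hfg.conjugate
    · rintro ⟨hX, hY, hc⟩
      obtain ⟨f, g, hfg⟩ := lconj_of_conjugate X.compact X.inv X.nonempty hc
      obtain ⟨N, hN⟩ := TT_eventually hfg X.compact X.inv X.nonempty hX.2.1 (hdeep X hX)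
      obtain ⟨k1, hk1⟩ := exists_Bd X
      obtain ⟨k2, hk2⟩ := exists_Bd Y
      exact ⟨N + k1 + k2, Or.inr ⟨hk1.mono (by omega), hk2.mono (by omega),
        fun n hn => hN n (by omega)⟩, hX, hY⟩

/-! ### Bi-infinite concatenations -/

def Cat (w : B → List C) (y : ℤ → B) (c : ℤ → ℤ) (z : ℤ → C) : Prop :=
  (∀ j, c (j + 1) = c j + (w (y j)).length) ∧
    ∀ (j : ℤ) (m : ℕ), m < (w (y j)).length → (w (y j))[m]? = some (z (c j + m))

lemma Cat.shift {w : B → List C} {y c z} (h : Cat w y c z) (p : ℤ) :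
    Cat w (shiftBy p y) (fun j => c (j + p)) z := by
  refine ⟨fun j => ?_, fun j m hm => h.2 (j + p) m hm⟩
  have := h.1 (j + p)
  simp only [shiftBy]
  rw [← this]; congr 1; ring

lemma Cat.trans {w : B → List C} {y c z} (h : Cat w y c z) (p : ℤ) :
    Cat w y (fun j => c j - p) (shiftBy p z) := by
  refine ⟨fun j => ?_, fun j m hm => ?_⟩
  · simp only []
    rw [h.1 j]; ring
  · rw [h.2 j m hm]
    simp only [shiftBy]
    congr 2; ring

lemma Cat.mono {w : B → List C} (hw : ∀ b, w b ≠ []) {y c z} (h : Cat w y c z) :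
    StrictMono c := by
  apply strictMono_int_of_lt_succ
  intro j
  rw [h.1 j]
  have := List.length_pos_iff.mpr (hw (y j))
  omega

lemma eq_of_steps {c c' s : ℤ → ℤ} (h : ∀ j, c (j + 1) = c j + s j)
    (h' : ∀ j, c' (j + 1) = c' j + s j) (h0 : c 0 = c' 0) : c = c' := by
  funext j
  induction j using Int.induction_on with
  | zero => exact h0
  | succ i ih => rw [h, h', ih]
  | pred i ih =>
    have h1 := h (-i - 1)
    have h2 := h' (-i - 1)
    rw [sub_add_cancel] at h1 h2
    omega

lemma exists_steps (s : ℤ → ℤ) (a : ℤ) : ∃ c : ℤ → ℤ, c 0 = a ∧ ∀ j, c (j + 1) = c j + s j := by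
  refine ⟨fun j => a + (∑ i ∈ Finset.range j.toNat, s i)
    - ∑ i ∈ Finset.range (-j).toNat, s (-(i : ℤ) - 1), by simp, fun j => ?_⟩
  rcases le_or_gt 0 j with hj | hj
  · obtain ⟨n, rfl⟩ := Int.eq_ofNat_of_zero_le hj
    have e1 : ((n : ℤ) + 1).toNat = n + 1 := by omega
    have e2 : (-((n : ℤ) + 1)).toNat = 0 := by omega
    have e3 : (-(n : ℤ)).toNat = 0 := by omega
    have e4 : (n : ℤ).toNat = n := by omega
    simp only [e1, e2, e3, e4, Finset.sum_range_succ]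
    simp; ring
  · obtain ⟨n, rfl⟩ : ∃ n : ℕ, j = -(n : ℤ) - 1 := ⟨(-j - 1).toNat, by omega⟩
    have e1 : (-(n : ℤ) - 1 + 1).toNat = 0 := by omega
    have e2 : (-(-(n : ℤ) - 1 + 1)).toNat = n := by omega
    have e3 : (-(-(n : ℤ) - 1)).toNat = n + 1 := by omega
    have e4 : (-(n : ℤ) - 1).toNat = 0 := by omega
    simp only [e1, e2, e3, e4, Finset.sum_range_succ]
    ring

lemma cut_exists {c : ℤ → ℤ} (h : StrictMono c) (i : ℤ) : ∃ j, c j ≤ i ∧ i < c (j + 1) := by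
  have hb : ∀ n : ℕ, c 0 + n ≤ c n ∧ c (-n) ≤ c 0 - n := by
    intro n
    induction n with
    | zero => simp
    | succ n ih =>
      have h1 : c n < c ((n + 1 : ℕ) : ℤ) := h (by push_cast; omega)
      have h2 : c (-((n + 1 : ℕ) : ℤ)) < c (-n) := h (by push_cast; omega)
      push_cast at *
      omega
  obtain ⟨n, hn1, hn2⟩ : ∃ n : ℕ, -(n : ℤ) ≤ i - c 0 ∧ i - c 0 ≤ n :=
    ⟨(i - c 0).natAbs, by omega, by omega⟩
  obtain ⟨j, hj, hmax⟩ := Int.exists_greatest_of_bdd (P := fun j => c j ≤ i)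
    ⟨((n + 1 : ℕ) : ℤ), fun z hz => by
      by_contra hlt
      push Not at hlt
      have h1 := h hlt
      have h2 := (hb (n + 1)).1
      push_cast at *
      omega⟩
    ⟨-(n : ℤ), by
      have h2 := (hb n).2
      omega⟩
  refine ⟨j, hj, ?_⟩
  by_contra hlt
  push Not at hlt
  have := hmax _ hlt
  omega

lemma cut_unique {c : ℤ → ℤ} (h : StrictMono c) {i j j' : ℤ} (h1 : c j ≤ i) (h2 : i < c (j + 1))
    (h1' : c j' ≤ i) (h2' : i < c (j' + 1)) : j = j' := by
  have a := h.lt_iff_lt.mp (h1.trans_lt h2')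
  have b := h.lt_iff_lt.mp (h1'.trans_lt h2)
  omega

lemma exists_cat {w : B → List C} (hw : ∀ b, w b ≠ []) (y : ℤ → B) (a : ℤ) :
    ∃ c z, c 0 = a ∧ Cat w y c z := by
  obtain ⟨c, h0, hc⟩ := exists_steps (fun j => ((w (y j)).length : ℤ)) a
  have hm : StrictMono c := by
    apply strictMono_int_of_lt_succ
    intro j
    rw [hc j]
    have := List.length_pos_iff.mpr (hw (y j))
    omega
  have key : ∀ i, ∃ b : C, ∀ j, c j ≤ i → i < c (j + 1) →
      (w (y j))[(i - c j).toNat]? = some b := by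
    intro i
    obtain ⟨j, h1, h2⟩ := cut_exists hm i
    have hlt : (i - c j).toNat < (w (y j)).length := by
      have := hc j
      omega
    refine ⟨(w (y j))[(i - c j).toNat], fun j' h1' h2' => ?_⟩
    obtain rfl := cut_unique hm h1 h2 h1' h2'
    exact List.getElem?_eq_getElem hlt
  choose z hz using key
  refine ⟨c, z, h0, hc, fun j m hlt => ?_⟩
  have := hz (c j + m) j (by omega) (by rw [hc j]; omega)
  rw [← this]; congr 1; omega

lemma Cat.congr_z {w : B → List C} (hw : ∀ b, w b ≠ []) {y c z z'} (h : Cat w y c z)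
    (h' : Cat w y c z') : z = z' := by
  funext i
  obtain ⟨j, h1, h2⟩ := cut_exists (h.mono hw) i
  have hlt : (i - c j).toNat < (w (y j)).length := by
    have := h.1 j
    omega
  have a := h.2 j _ hlt
  rw [h'.2 j _ hlt] at a
  have e : c j + ((i - c j).toNat : ℤ) = i := by omega
  rw [e] at a
  exact (Option.some.inj a).symm

/-! ### Words inside concatenations -/

/-- the word `u` occurs in `y` at position `d` -/
def OccAt (u : List B) (y : ℤ → B) (d : ℤ) : Prop :=
  ∀ m : ℕ, m < u.length → u[m]? = some (y (d + m))

lemma OccAt.cons {b : B} {u : List B} {y : ℤ → B} {d : ℤ} :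
    OccAt (b :: u) y d ↔ y d = b ∧ OccAt u y (d + 1) := by
  constructor
  · intro h
    refine ⟨?_, fun m hm => ?_⟩
    · have := h 0 (by simp)
      simpa using this.symm
    · have := h (m + 1) (by simpa using hm)
      rw [List.getElem?_cons_succ] at this
      rw [this]; congr 2; push_cast; ring
  · rintro ⟨rfl, h⟩ m hm
    cases m with
    | zero => simp
    | succ m =>
      rw [List.getElem?_cons_succ, h m (by simpa using hm)]
      congr 2; push_cast; ring

lemma OccAt.append {u v : List B} {y : ℤ → B} {d : ℤ} :
    OccAt (u ++ v) y d ↔ OccAt u y d ∧ OccAt v y (d + u.length) := by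
  induction u generalizing d with
  | nil => simp [OccAt]
  | cons b u ih =>
    rw [List.cons_append, OccAt.cons, ih, OccAt.cons, and_assoc]
    have : d + 1 + (u.length : ℤ) = d + ((b :: u).length : ℤ) := by
      rw [List.length_cons]; push_cast; ring
    rw [this]

lemma cat_iff {w : B → List C} {y c z} : Cat w y c z ↔
    (∀ j, c (j + 1) = c j + (w (y j)).length) ∧ ∀ j, OccAt (w (y j)) z (c j) := Iff.rfl

lemma factorAt_occ {u : List B} {y : ℤ → B} {d : ℤ} : OccAt u y d ↔ factorAt y d u.length = u := by
  induction u generalizing d with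
  | nil => simp [OccAt, factorAt_def]
  | cons b u ih =>
    rw [OccAt.cons, ih, factorAt_def, factorAt_def, List.length_cons, List.range_succ_eq_map]
    simp only [List.map_cons, List.map_map, List.cons.injEq]
    have e : (fun j : ℕ => y (d + 1 + (j : ℤ))) = (fun j : ℕ => y (d + (j : ℤ))) ∘ Nat.succ := by
      funext j; simp only [Function.comp]; congr 1; push_cast; ring
    rw [e]
    simp

/-- push an occurrence up through a concatenation -/
lemma occ_flatMap {w : B → List C} {y c z} (h : Cat w y c z) (u : List B) (d : ℤ) 
    (hu : OccAt u y d) :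
    c (d + u.length) = c d + (u.flatMap w).length ∧ OccAt (u.flatMap w) z (c d) := by
  induction u generalizing d with
  | nil => simp [OccAt]
  | cons b u ih =>
    rw [OccAt.cons] at hu
    obtain ⟨rfl, hu⟩ := hu
    obtain ⟨h1, h2⟩ := ih _ hu
    rw [h.1 d] at h1 h2
    rw [List.flatMap_cons, OccAt.append]
    refine ⟨?_, h.2 d, h2⟩
    rw [List.length_append, List.length_cons]
    push_cast
    rw [← add_assoc, ← add_assoc, ← h1]; congr 1; ring

lemma Cat.comp {σ : A → List B} {w : B → List C} {y d u c z} (h : Cat σ y d u) (h' : Cat w u c z) :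
    Cat (fun a => (σ a).flatMap w) y (fun j => c (d j)) z := by
  refine ⟨fun j => ?_, fun j => ?_⟩
  · have := (occ_flatMap h' _ _ (h.2 j)).1
    simp only []
    rw [h.1 j, this]
  · exact (occ_flatMap h' _ _ (h.2 j)).2

lemma Cat.decomp {σ : A → List B} {w : B → List C} (hσ : ∀ a, σ a ≠ []) (hw : ∀ b, w b ≠ [])
    {y : ℤ → A} {c' z} (h : Cat (fun a => (σ a).flatMap w) y c' z) :
    ∃ d u c, Cat σ y d u ∧ Cat w u c z ∧ ∀ j, c' j = c (d j) := by
  obtain ⟨d, u, h0, hd⟩ := exists_cat hσ y 0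
  obtain ⟨c, z', hc0, hc⟩ := exists_cat hw u (c' 0)
  have hcomp := hd.comp hc
  have e : c' = fun j => c (d j) := by
    refine eq_of_steps h.1 hcomp.1 ?_
    simp [h0, hc0]
  have hne : ∀ a, (σ a).flatMap w ≠ [] := by
    intro a ha
    rw [List.flatMap_eq_nil_iff] at ha
    obtain ⟨b, hb⟩ := List.exists_mem_of_ne_nil _ (hσ a)
    exact hw b (ha b hb)
  rw [e] at h
  have := h.congr_z hne hcomp
  subst this
  exact ⟨d, u, c, hd, hc, fun j => congrFun e j⟩

/-! ### Uniqueness -/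

def RepU (w : B → List C) (Y : Set (ℤ → B)) : Prop :=
  ∀ x y y' c c', y ∈ Y → y' ∈ Y → Cat w y c x → Cat w y' c' x → c 0 ≤ 0 → 0 < c 1 →
    c' 0 ≤ 0 → 0 < c' 1 → y = y' ∧ c = c'

lemma rep_of_cat {w : B → List C} {Y : Set (ℤ → B)} {x y c} (hy : y ∈ Y) (h : Cat w y c x)
    (h0 : c 0 ≤ 0) (h1 : 0 < c 1) : IsCenteredRep w Y x y (-c 0).toNat := by
  have := h.1 0
  rw [zero_add] at this
  refine ⟨hy, by omega, fun j => c j - c 0, by simp, fun j => ?_, fun j m => ?_⟩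
  · show c (j + 1) - c 0 = c j - c 0 + _
    rw [h.1 j]; ring
  · have := h.2 j m m.2
    rw [List.getElem?_eq_getElem m.2] at this
    have h2 := Option.some.inj this
    rw [List.get_eq_getElem, h2]
    simp only []
    congr 1; omega

lemma repU_of_rec {w : B → List C} {Y : Set (ℤ → B)} (h : RecognizableIn w Y) : RepU w Y := by
  intro x y y' c c' hy hy' hc hc' h0 h1 h0' h1'
  obtain ⟨rfl, e⟩ := h x y y' _ _ (rep_of_cat hy hc h0 h1) (rep_of_cat hy' hc' h0' h1')
  exact ⟨rfl, eq_of_steps hc.1 hc'.1 (by omega)⟩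

lemma repU_comp {σ : A → List B} {w : B → List C} (hσ : ∀ a, σ a ≠ []) (hw : ∀ b, w b ≠ [])
    {Y : Set (ℤ → A)} {U : Set (ℤ → B)} (hU : Inv U)
    (hYU : ∀ y ∈ Y, ∀ d u, Cat σ y d u → u ∈ U) (h1 : RepU σ Y) (h2 : RepU w U) :
    RepU (fun a => (σ a).flatMap w) Y := by
  intro x y y' C0 C1 hy hy' hc hc' a0 a1 b0 b1
  obtain ⟨d, u, c, k1, k2, k3⟩ := hc.decomp hσ hw
  obtain ⟨d', u', c', k1', k2', k3'⟩ := hc'.decomp hσ hw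
  obtain ⟨j, hj1, hj2⟩ := cut_exists (k2.mono hw) 0
  obtain ⟨j', hj1', hj2'⟩ := cut_exists (k2'.mono hw) 0
  obtain ⟨e1, e2⟩ := h2 x (shiftBy j u) (shiftBy j' u') _ _ (hU _ (hYU y hy d u k1) _)
    (hU _ (hYU y' hy' d' u' k1') _) (k2.shift j) (k2'.shift j') (by simpa using hj1)
    (by simpa [add_comm] using hj2) (by simpa using hj1') (by simpa [add_comm] using hj2')
  have m1 := k2.mono hw
  have m2 := k2'.mono hw
  rw [k3] at a0 a1
  rw [k3'] at b0 b1
  have q1 := m1.lt_iff_lt.mp (a0.trans_lt hj2)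
  have q2 := m1.lt_iff_lt.mp (hj1.trans_lt a1)
  have q1' := m2.lt_iff_lt.mp (b0.trans_lt hj2')
  have q2' := m2.lt_iff_lt.mp (hj1'.trans_lt b1)
  have t1 := k1.trans j
  have t2 := k1'.trans j'
  rw [← e1] at t2
  obtain ⟨e3, e4⟩ := h1 _ y y' _ _ hy hy' t1 t2 (by omega) (by omega)
    (by omega) (by omega)
  refine ⟨e3, funext fun i => ?_⟩
  rw [k3, k3']
  have f1 := congrFun e4 i
  have f2 := congrFun e2 (d i - j)
  rw [f1] at f2
  simp only [sub_add_cancel] at f2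
  rw [← f1] at f2
  simpa using f2

lemma factorAt_length (x : ℤ → A) (i : ℤ) (n : ℕ) : (factorAt x i n).length = n := by
  simp [factorAt_def]

lemma occ_factorAt (x : ℤ → A) (i : ℤ) (n : ℕ) : OccAt (factorAt x i n) x i := by
  rw [factorAt_occ, factorAt_length]

lemma factorAt_add (x : ℤ → A) (i : ℤ) (p q : ℕ) :
    factorAt x i (p + q) = factorAt x i p ++ factorAt x (i + p) q := by
  have h : OccAt (factorAt x i p ++ factorAt x (i + p) q) x i := by
    rw [OccAt.append, factorAt_length]
    exact ⟨occ_factorAt _ _ _, occ_factorAt _ _ _⟩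
  rw [factorAt_occ, List.length_append, factorAt_length, factorAt_length] at h
  exact h

lemma infix_of_occ {v : List A} {u : ℤ → A} {a : ℤ} (h : OccAt v u a) {i : ℤ} {m : ℕ}
    (h1 : a ≤ i) (h2 : i + m ≤ a + v.length) : factorAt u i m <:+: v := by
  rw [factorAt_occ] at h
  obtain ⟨p, hp⟩ : ∃ p : ℕ, i = a + p := ⟨(i - a).toNat, by omega⟩
  obtain ⟨q, hq⟩ : ∃ q : ℕ, v.length = p + m + q := ⟨v.length - (p + m), by omega⟩
  rw [hq, factorAt_add, factorAt_add] at h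
  rw [hp, ← h]
  exact ⟨_, _, rfl⟩

lemma closed_disc {Ω D : Type*} [TopologicalSpace Ω] [TopologicalSpace D] [DiscreteTopology D]
    {g : Ω → D} (hg : Continuous g) (P : D → Prop) : IsClosed {p | P (g p)} :=
  (isClosed_discrete {d | P d}).preimage hg

lemma closed_and {Ω : Type*} [TopologicalSpace Ω] {P Q : Ω → Prop} (h1 : IsClosed {p | P p})
    (h2 : IsClosed {p | Q p}) : IsClosed {p | P p ∧ Q p} := h1.inter h2

lemma closed_all {Ω ι : Type*} [TopologicalSpace Ω] {P : ι → Ω → Prop}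
    (h : ∀ i, IsClosed {p | P i p}) : IsClosed {p | ∀ i, P i p} := by
  rw [ofPred_forall]
  exact isClosed_iInter h

lemma closed_factor [TopologicalSpace A] [DiscreteTopology A] (Q : List A → Prop) (i : ℤ) (m : ℕ) :
    IsClosed {y : ℤ → A | Q (factorAt y i m)} := by
  have h : ∀ y : ℤ → A, factorAt y i m = List.ofFn (fun j : Fin m => y (i + (j : ℕ))) := by
    intro y
    apply List.ext_getElem
    · simp [factorAt_length]
    · intro j h1 h2
      simp [factorAt_def]
  simp only [h]
  exact closed_disc (g := fun (y : ℤ → A) (j : Fin m) => y (i + (j : ℕ)))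
    (continuous_pi fun j => continuous_apply _) (fun f => Q (List.ofFn f))

/-- a priori bound on centered cutting functions -/
lemma cut_bound {c s : ℤ → ℤ} {R : ℕ} (h : ∀ j, c (j + 1) = c j + s j) (hs0 : ∀ j, 0 ≤ s j)
    (hs : ∀ j, s j ≤ R) (h0 : c 0 ≤ 0) (h1 : 0 < c 1) (n : ℕ) :
    c n ≤ R * n ∧ -(R : ℤ) ≤ c n ∧ c (-n) ≤ 0 ∧ -(R * (n + 1) : ℤ) ≤ c (-n) := by
  have e := h 0
  have e' := hs 0
  rw [zero_add] at e
  induction n with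
  | zero => simp; omega
  | succ n ih =>
    have a1 := h n
    have a2 := h (-((n + 1 : ℕ) : ℤ))
    have a3 := hs n
    have a4 := hs (-((n + 1 : ℕ) : ℤ))
    have a5 := hs0 n
    have a6 := hs0 (-((n + 1 : ℕ) : ℤ))
    have a7 : -((n + 1 : ℕ) : ℤ) + 1 = -n := by push_cast; ring
    rw [a7] at a2
    push_cast at *
    obtain ⟨b1, b2, b3, b4⟩ := ih
    refine ⟨?_, ?_, ?_, ?_⟩ <;> nlinarith

def box (R : ℕ) (j : ℤ) : Set ℤ := Icc (-(R * (j.natAbs + 1) : ℤ)) (R * (j.natAbs + 1))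

lemma cut_box {c s : ℤ → ℤ} {R : ℕ} (h : ∀ j, c (j + 1) = c j + s j) (hs0 : ∀ j, 0 ≤ s j)
    (hs : ∀ j, s j ≤ R) (h0 : c 0 ≤ 0) (h1 : 0 < c 1) (j : ℤ) : c j ∈ box R j := by
  obtain ⟨b1, b2, b3, b4⟩ := cut_bound h hs0 hs h0 h1 j.natAbs
  rcases Int.natAbs_eq j with e | e
  · rw [← e] at b1 b2
    have hr : (0 : ℤ) ≤ (R : ℤ) * (j.natAbs : ℤ) := by positivity
    refine ⟨?_, ?_⟩ <;> nlinarith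
  · rw [← e] at b3 b4
    have hr : (0 : ℤ) ≤ (R : ℤ) * (j.natAbs : ℤ) := by positivity
    refine ⟨?_, ?_⟩ <;> nlinarith

lemma box_compact (R : ℕ) : IsCompact {c : ℤ → ℤ | ∀ j, c j ∈ box R j} := by
  have := isCompact_univ_pi (s := fun j => box R j) (fun j => isCompact_Icc)
  convert this using 1
  ext c; simp

lemma len_bound [Finite A] (s : A → List B) : ∃ R : ℕ, 0 < R ∧ ∀ a, (s a).length ≤ R := by
  cases nonempty_fintype A
  exact ⟨Finset.univ.sup (fun a => (s a).length) + 1, by omega, fun a =>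
    (Finset.le_sup (f := fun a => (s a).length) (Finset.mem_univ a)).trans (by omega)⟩

lemma exists_up [Finite A] {s : A → List B} (hs : ∀ a, s a ≠ []) (Q : List A → Prop)
    (hQ : ∀ u v, u <:+: v → Q v → Q u) (x : ℤ → B)
    (H : ∀ M : ℕ, ∃ ws, Q ws ∧ factorAt x (-M) (2 * M + 1) <:+: ws.flatMap s) :
    ∃ y c, (∀ i m, Q (factorAt y i m)) ∧ Cat s y c x ∧ c 0 ≤ 0 ∧ 0 < c 1 := by
  letI : TopologicalSpace A := ⊥
  have : DiscreteTopology A := ⟨rfl⟩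
  obtain ⟨R, hR0, hR⟩ := len_bound s
  let F : ℕ → Set ((ℤ → A) × (ℤ → ℤ)) := fun N => {p |
    (∀ i, ∀ m : ℕ, -(N : ℤ) ≤ i → i + m ≤ N → Q (factorAt p.1 i m)) ∧
    (∀ j, p.2 (j + 1) = p.2 j + (s (p.1 j)).length) ∧
    (∀ j, ∀ m : ℕ, m < (s (p.1 j)).length → -(N : ℤ) ≤ p.2 j + m → p.2 j + m ≤ N →
      (s (p.1 j))[m]? = some (x (p.2 j + m))) ∧ p.2 0 ≤ 0 ∧ 0 < p.2 1 ∧ ∀ j, p.2 j ∈ box R j}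
  have c1 : ∀ j, Continuous fun p : (ℤ → A) × (ℤ → ℤ) => p.1 j := fun j =>
    (continuous_apply j).comp continuous_fst
  have c2 : ∀ j, Continuous fun p : (ℤ → A) × (ℤ → ℤ) => p.2 j := fun j =>
    (continuous_apply j).comp continuous_snd
  have hcl : ∀ N, IsClosed (F N) := by
    intro N
    dsimp only [F]
    refine closed_and ?_ (closed_and ?_ (closed_and ?_ (closed_and ?_
      (closed_and ?_ ?_))))
    · exact closed_all fun i => closed_all fun m =>
        (closed_factor (fun l => -(N : ℤ) ≤ i → i + m ≤ N → Q l) i m).preimage continuous_fst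
    · exact closed_all fun j => closed_disc ((c2 (j + 1)).prodMk ((c2 j).prodMk (c1 j)))
        (fun t : ℤ × ℤ × A => t.1 = t.2.1 + (s t.2.2).length)
    · refine closed_all fun j => closed_all fun m => ?_
      exact closed_disc ((c2 j).prodMk (c1 j)) (fun t : ℤ × A => m < (s t.2).length →
        -(N : ℤ) ≤ t.1 + m → t.1 + m ≤ N → (s t.2)[m]? = some (x (t.1 + m)))
    · exact closed_disc (c2 0) (fun t => t ≤ 0)
    · exact closed_disc (c2 1) (fun t => 0 < t)
    · exact closed_all fun j => closed_disc (c2 j) (fun t => t ∈ box R j)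
  have hne : ∀ N, (F N).Nonempty := by
    intro N
    obtain ⟨M, hM⟩ : ∃ M : ℕ, M = R * (N + 1) + N + 1 := ⟨_, rfl⟩
    obtain ⟨ws, hws, p, t, e⟩ := H M
    have hne : ws ≠ [] := by
      rintro rfl
      have := congrArg List.length e
      simp [factorAt_length] at this
    have : Nonempty A := ⟨ws.head hne⟩
    let y0 : ℤ → A := fun j => ws.getD j.toNat (Classical.arbitrary A)
    have ho : OccAt ws y0 0 := by
      intro m hm
      simp [y0, List.getElem?_eq_getElem hm]
    obtain ⟨c0, z0, hc0, hcat⟩ := exists_cat hs y0 (-(p.length + M : ℤ))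
    obtain ⟨o1, o2⟩ := occ_flatMap hcat ws 0 ho
    have hmono := hcat.mono hs
    rw [hc0, zero_add] at o1
    rw [← e, hc0, List.append_assoc, OccAt.append, OccAt.append] at o2
    have o3 := o2.2.1
    have eL : (ws.flatMap s).length = p.length + (2 * M + 1) + t.length := by
      rw [← e]; simp [factorAt_length, add_assoc]
    have hz : ∀ i : ℤ, -(M : ℤ) ≤ i → i ≤ M → z0 i = x i := by
      intro i h1 h2
      rw [factorAt_occ, factorAt_length, factorAt_eq_iff] at o3
      have := o3 (i + M).toNat (by omega)
      convert this using 2 <;> omega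
    obtain ⟨j0, hj1, hj2⟩ := cut_exists hmono 0
    have hsh := hcat.shift j0
    have b0 : (fun j => c0 (j + j0)) 0 ≤ 0 := by simpa using hj1
    have b1 : 0 < (fun j => c0 (j + j0)) 1 := by simpa [add_comm] using hj2
    have hl : ∀ j, (0 : ℤ) ≤ ((s (shiftBy j0 y0 j)).length : ℤ) := fun j => by positivity
    have hl' : ∀ j, ((s (shiftBy j0 y0 j)).length : ℤ) ≤ R := fun j => by exact_mod_cast hR _
    obtain ⟨q1, q2, q3, q4⟩ := cut_bound (c := fun j => c0 (j + j0)) hsh.1 hl hl' b0 b1 N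
    have g1 : 0 ≤ j0 - N := by
      by_contra hlt
      push Not at hlt
      have := hmono hlt
      rw [hc0] at this
      have e2 : -(N : ℤ) + j0 = j0 - N := by ring
      simp only [e2] at q4
      push_cast [hM] at this
      linarith
    have g2 : j0 + N ≤ ws.length := by
      by_contra hlt
      push Not at hlt
      have := hmono hlt
      rw [o1, eL] at this
      simp only [add_comm (N : ℤ) j0] at q1
      push_cast at this
      have hM' : (M : ℤ) = R * (N + 1) + N + 1 := by exact_mod_cast hM
      nlinarith
    refine ⟨(shiftBy j0 y0, fun j => c0 (j + j0)), ?_, hsh.1, ?_, b0, b1,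
      cut_box (c := fun j => c0 (j + j0)) hsh.1 hl hl' b0 b1⟩
    · intro i m h1 h2
      have e3 : factorAt (shiftBy j0 y0) i m = factorAt y0 (i + j0) m := by
        rw [factorAt_eq_iff]
        intro j _
        simp only [shiftBy]; congr 1; ring
      simp only [e3]
      exact hQ _ _ (infix_of_occ ho (by omega) (by omega)) hws
    · intro j m hm h1 h2
      rw [← hz _ (by simp only [] at h1 ⊢; nlinarith) (by simp only [] at h2 ⊢; nlinarith)]
      exact hsh.2 j m hm
  obtain ⟨⟨y, c⟩, hp⟩ := IsCompact.nonempty_iInter_of_sequence_nonempty_isCompact_isClosed F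
    (by
      rintro N p ⟨h1, h2, h3, h4, h5, h6⟩
      exact ⟨fun i m a b => h1 i m (by push_cast; omega) (by push_cast; omega), h2,
        fun j m a b d => h3 j m a (by push_cast; omega) (by push_cast; omega), h4, h5, h6⟩) hne
    (by
      refine (isCompact_univ.prod (box_compact R)).of_isClosed_subset (hcl 0) ?_
      rintro p ⟨h1, h2, h3, h4, h5, h6⟩
      exact ⟨trivial, h6⟩) hcl
  rw [mem_iInter] at hp
  refine ⟨y, c, fun i m => ?_, ⟨(hp 0).2.1, fun j m hm => ?_⟩, (hp 0).2.2.2.1, (hp 0).2.2.2.2.1⟩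
  · exact (hp (i.natAbs + m)).1 i m (by omega) (by omega)
  · exact (hp ((c j).natAbs + m)).2.2.1 j m hm (by show _ ≤ c j + _; omega)
      (by show c j + _ ≤ _; omega)

lemma str_of_rep [Finite B] [Finite C] [Nonempty B] {w : B → List C} (hw : ∀ b, w b ≠ [])
    (Q : List B → Prop) {Y : Set (ℤ → B)} (hYQ : Y = {y | ∀ i m, Q (factorAt y i m)})
    (hY : Inv Y) (hU : RepU w Y) : ∃ r h, IsLoc r h ∧
      ∀ x y c, y ∈ Y → Cat w y c x → c 0 ≤ 0 → 0 < c 1 → Tow (len w) (h x) ∧ Fills w (h x) x := by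
  classical
  letI : TopologicalSpace B := ⊥
  have : DiscreteTopology B := ⟨rfl⟩
  letI : TopologicalSpace C := ⊥
  have : DiscreteTopology C := ⟨rfl⟩
  obtain ⟨R, hR0, hR⟩ := len_bound w
  let S : Set ((ℤ → C) × (ℤ → B) × (ℤ → ℤ)) :=
    {p | p.2.1 ∈ Y ∧ Cat w p.2.1 p.2.2 p.1 ∧ p.2.2 0 ≤ 0 ∧ 0 < p.2.2 1}
  have c0 : ∀ j, Continuous fun p : (ℤ → C) × (ℤ → B) × (ℤ → ℤ) => p.1 j := fun j =>
    (continuous_apply j).comp continuous_fst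
  have c1 : ∀ j, Continuous fun p : (ℤ → C) × (ℤ → B) × (ℤ → ℤ) => p.2.1 j := fun j =>
    (continuous_apply j).comp (continuous_fst.comp continuous_snd)
  have c2 : ∀ j, Continuous fun p : (ℤ → C) × (ℤ → B) × (ℤ → ℤ) => p.2.2 j := fun j =>
    (continuous_apply j).comp (continuous_snd.comp continuous_snd)
  have hcl : IsClosed S := by
    dsimp only [S, Cat]
    refine closed_and ?_ (closed_and (closed_and ?_ ?_) (closed_and ?_ ?_))
    · rw [hYQ]
      refine IsClosed.preimage (continuous_fst.comp continuous_snd) ?_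
      exact closed_all fun i => closed_all fun m => closed_factor Q i m
    · exact closed_all fun j => closed_disc ((c2 (j + 1)).prodMk ((c2 j).prodMk (c1 j)))
        (fun t : ℤ × ℤ × B => t.1 = t.2.1 + (w t.2.2).length)
    · refine closed_all fun j => closed_all fun m => ?_
      have hev : Continuous fun p : (ℤ → C) × (ℤ → B) × (ℤ → ℤ) => p.1 (p.2.2 j + m) := by
        have h1 : Continuous fun q : (ℤ → C) × ℤ => q.1 (q.2 + m) := by
          rw [continuous_prod_of_discrete_right]
          intro b
          exact continuous_apply (A := fun _ : ℤ => C) (b + m)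
        exact h1.comp (continuous_fst.prodMk (c2 j))
      exact closed_disc (hev.prodMk (c1 j)) (fun t : C × B => m < (w t.2).length →
        (w t.2)[m]? = some t.1)
    · exact closed_disc (c2 0) (fun t => t ≤ 0)
    · exact closed_disc (c2 1) (fun t => 0 < t)
  have hcomp : IsCompact S := by
    refine (isCompact_univ.prod (isCompact_univ.prod (box_compact R))).of_isClosed_subset hcl ?_
    rintro p ⟨h1, h2, h3, h4⟩
    exact ⟨trivial, trivial, cut_box h2.1 (fun j => by positivity)
      (fun j => by exact_mod_cast hR _) h3 h4⟩
  have : CompactSpace S := isCompact_iff_compactSpace.mp hcomp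
  have hmono : ∀ ω : S, StrictMono ω.1.2.2 := fun ω => ω.2.2.1.mono hw
  let J : S → ℤ → ℤ := fun ω i => (cut_exists (hmono ω) i).choose
  have hJ : ∀ (ω : S) (i : ℤ), ω.1.2.2 (J ω i) ≤ i ∧ i < ω.1.2.2 (J ω i + 1) := fun ω i =>
    (cut_exists (hmono ω) i).choose_spec
  let ρ : S → ℤ → B × ℕ := fun ω i => (ω.1.2.1 (J ω i), (i - ω.1.2.2 (J ω i)).toNat)
  have hρ : ∀ (ω : S) i j, ω.1.2.2 j ≤ i → i < ω.1.2.2 (j + 1) →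
      ρ ω i = (ω.1.2.1 j, (i - ω.1.2.2 j).toNat) := by
    intro ω i j h1 h2
    obtain rfl := cut_unique (hmono ω) h1 h2 (hJ ω i).1 (hJ ω i).2
    rfl
  have hρ0 : ∀ ω : S, ρ ω 0 = (ω.1.2.1 0, (0 - ω.1.2.2 0).toNat) := fun ω =>
    hρ ω 0 0 ω.2.2.2.1 (by rw [zero_add]; exact ω.2.2.2.2)
  obtain ⟨r, h, hloc, hh⟩ := local_of_inj (Ω := S) (π := fun ω => ω.1.1) (ρ := ρ)
    (fun i => (c0 i).comp continuous_subtype_val)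
    (by
      simp only [hρ0]
      exact ((c1 0).comp continuous_subtype_val).prodMk
        ((continuous_of_discreteTopology (f := fun t : ℤ => (0 - t).toNat)).comp
          ((c2 0).comp continuous_subtype_val)))
    (by
      intro ω k
      have t := (ω.2.2.1.shift (J ω k)).trans k
      refine ⟨⟨(shiftBy k ω.1.1, shiftBy (J ω k) ω.1.2.1, fun j => ω.1.2.2 (j + J ω k) - k),
        hY _ ω.2.1 _, t, ?_, ?_⟩, rfl, ?_⟩
      · have := (hJ ω k).1
        simpa using this
      · have := (hJ ω k).2
        simpa [add_comm] using this
      · funext i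
        have a := hJ ω (i + k)
        rw [hρ _ i (J ω (i + k) - J ω k) (by simp; omega) (by
          have e : J ω (i + k) - J ω k + 1 + J ω k = J ω (i + k) + 1 := by ring
          simp only [e]; omega)]
        simp only [shiftBy, ρ, sub_add_cancel]
        congr 2; ring)
    (by
      intro ω ω' e
      have e' : ω.1.1 = ω'.1.1 := e
      have hc' := ω'.2.2.1
      rw [← e'] at hc'
      obtain ⟨a, b⟩ := hU _ _ _ _ _ ω.2.1 ω'.2.1 ω.2.2.1 hc' ω.2.2.2.1 ω.2.2.2.2
        ω'.2.2.2.1 ω'.2.2.2.2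
      rw [hρ0, hρ0, a, b])
  refine ⟨r, h, hloc, fun x y c hy hc h0 h1 => ?_⟩
  let ω : S := ⟨(x, y, c), hy, hc, h0, h1⟩
  have e : h x = ρ ω := hh ω
  rw [e]
  have hm : StrictMono c := hc.mono hw
  refine ⟨fun i => ?_, fun i => ?_⟩
  · obtain ⟨j, k1, k2⟩ := cut_exists hm i
    have s1 := hc.1 j
    rw [hρ ω i j k1 k2]
    by_cases hlt : i + 1 < c (j + 1)
    · left
      rw [hρ ω (i + 1) j (by show c j ≤ _; omega) hlt]
      refine ⟨?_, ?_⟩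
      · show (i - c j).toNat + 1 < (w (y j)).length
        omega
      · show (y j, (i + 1 - c j).toNat) = (y j, (i - c j).toNat + 1)
        congr 1; omega
    · right
      have s2 : i + 1 = c (j + 1) := by omega
      refine ⟨?_, ?_⟩
      · show (i - c j).toNat + 1 = (w (y j)).length
        omega
      · rw [hρ ω (i + 1) (j + 1) (by show c (j + 1) ≤ _; omega)
          (by show _ < c (j + 1 + 1); rw [s2]; exact hm (by omega))]
        show (i + 1 - c (j + 1)).toNat = 0
        omega
  · obtain ⟨j, k1, k2⟩ := cut_exists hm i
    have s1 := hc.1 j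
    rw [hρ ω i j k1 k2]
    show (w (y j))[(i - c j).toNat]? = some (x i)
    rw [hc.2 j _ (by omega)]
    congr 2; omega

section sadic
variable {E : ℕ → Type} {σ : ∀ n, E (n + 1) → List (E n)}

lemma flatMap_cast {D : Type*} {p q : ℕ} (e : p = q) (h : p + 1 = q + 1) (a : E (p + 1))
    (f : E q → List D) :
    (σ q (h ▸ a)).flatMap f = (σ p a).flatMap (fun b => f (e ▸ b)) := by
  subst e; rfl

lemma sadic_succ (σ : ∀ n, E (n + 1) → List (E n)) (n k : ℕ) :
    ∀ (m : ℕ) (h1 : m = n + 1 + k) (h2 : m = n + (k + 1)) (a : E m),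
      sadicWordAux σ n (k + 1) (h2 ▸ a) = (sadicWordAux σ (n + 1) k (h1 ▸ a)).flatMap (σ n) := by
  induction k with
  | zero =>
    intro m h1 h2 a
    subst h1
    show (σ n a).flatMap (fun b => [b]) = [a].flatMap (σ n)
    simp
  | succ k ih =>
    intro m h1 h2 a
    subst h1
    show (σ (n + (k + 1)) (h2 ▸ a)).flatMap (sadicWordAux σ n (k + 1)) =
      ((σ (n + 1 + k) a).flatMap (sadicWordAux σ (n + 1) k)).flatMap (σ n)
    rw [List.flatMap_assoc]
    have e : n + 1 + k = n + (k + 1) := by omega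
    rw [flatMap_cast (σ := σ) e h2 a]
    congr 1
    funext b
    exact ih _ rfl e b

def InL (σ : ∀ n, E (n + 1) → List (E n)) (n : ℕ) (u : List (E n)) : Prop :=
  ∃ k : ℕ, 0 < k ∧ ∃ a : E (n + k), u <:+: sadicWordAux σ n k a

lemma InL.mono {n : ℕ} (u v : List (E n)) (h : u <:+: v) (hv : InL σ n v) : InL σ n u := by
  obtain ⟨k, hk, a, ha⟩ := hv
  exact ⟨k, hk, a, h.trans ha⟩

lemma xlevel_eq (n : ℕ) : XLevel σ n = {y | ∀ i m, InL σ n (factorAt y i m)} := rfl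

lemma infix_flatMap {u v : List A} (h : u <:+: v) (f : A → List B) :
    u.flatMap f <:+: v.flatMap f := by
  obtain ⟨p, q, rfl⟩ := h
  exact ⟨p.flatMap f, q.flatMap f, by simp⟩

lemma InL.down {n : ℕ} {u : List (E (n + 1))} (h : InL σ (n + 1) u) :
    InL σ n (u.flatMap (σ n)) := by
  obtain ⟨k, hk, a, ha⟩ := h
  have e : n + 1 + k = n + (k + 1) := by omega
  refine ⟨k + 1, by omega, e ▸ a, ?_⟩
  rw [sadic_succ σ n k _ rfl e a]
  exact infix_flatMap ha _

lemma xlevel_inv (n : ℕ) : Inv (XLevel σ n) := by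
  intro y hy k i m
  have e : factorAt (shiftBy k y) i m = factorAt y (i + k) m := by
    rw [factorAt_eq_iff]
    intro j _
    simp only [shiftBy]; congr 1; ring
  rw [e]
  exact hy _ _

lemma cat_down (hne : NonErasing σ) {n : ℕ} {y : ℤ → E (n + 1)} (hy : y ∈ XLevel σ (n + 1))
    {d u} (h : Cat (σ n) y d u) : u ∈ XLevel σ n := by
  intro i m
  have hm := h.mono (hne n)
  obtain ⟨j, h1, h2⟩ := cut_exists hm i
  obtain ⟨e1, e2⟩ := occ_flatMap h _ j (occ_factorAt y j (m + 1))
  have hgrow : ∀ t : ℕ, d (j + 1) + t ≤ d (j + 1 + t) := by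
    intro t
    induction t with
    | zero => simp
    | succ t ih =>
      have := hm (show j + 1 + (t : ℤ) < j + 1 + ((t + 1 : ℕ) : ℤ) by push_cast; omega)
      push_cast at *
      omega
  have := hgrow m
  rw [factorAt_length] at e1
  have e3 : j + ((m + 1 : ℕ) : ℤ) = j + 1 + m := by push_cast; ring
  rw [e3] at e1
  exact InL.mono _ _ (infix_of_occ e2 (by omega) (by omega)) (InL.down (hy _ _))

lemma up [∀ n, Fintype (E n)] (hne : NonErasing σ) {n : ℕ} {x : ℤ → E n} (hx : x ∈ XLevel σ n) :
    ∃ y c, y ∈ XLevel σ (n + 1) ∧ Cat (σ n) y c x ∧ c 0 ≤ 0 ∧ 0 < c 1 := by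
  refine exists_up (hne n) (InL σ (n + 1)) (fun u v => InL.mono u v) x fun M => ?_
  obtain ⟨R, hR0, hR⟩ := len_bound (σ n)
  obtain ⟨k, hk, a, ha⟩ := hx (-((M + R : ℕ) : ℤ)) (2 * (M + R) + 1)
  have hsub : factorAt x (-M) (2 * M + 1) <:+: factorAt x (-((M + R : ℕ) : ℤ)) (2 * (M + R) + 1) :=
    infix_of_occ (occ_factorAt _ _ _) (by push_cast; omega)
      (by rw [factorAt_length]; push_cast; omega)
  obtain ⟨k, rfl⟩ : ∃ k', k = k' + 1 := ⟨k - 1, by omega⟩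
  have e : n + (k + 1) = n + 1 + k := by omega
  have key := sadic_succ σ n k _ e rfl a
  change sadicWordAux σ n (k + 1) a = _ at key
  rw [key] at ha
  rcases Nat.eq_zero_or_pos k with rfl | hk'
  · exfalso
    have := ha.length_le
    rw [factorAt_length] at this
    simp only [sadicWordAux, List.flatMap_cons, List.flatMap_nil, List.append_nil] at this
    have := hR a
    omega
  · exact ⟨_, ⟨k, hk', _, List.infix_rfl⟩, hsub.trans ha⟩

lemma word0_ne (hne : NonErasing σ) (n : ℕ) (a : E n) : word0 σ n a ≠ [] := by
  induction n with
  | zero => simp [word0]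
  | succ n ih =>
    intro h
    rw [word0, List.flatMap_eq_nil_iff] at h
    obtain ⟨b, hb⟩ := List.exists_mem_of_ne_nil _ (hne n a)
    exact ih b (h b hb)

lemma cat_id (x : ℤ → A) : Cat (fun a => [a]) x id x := by
  refine ⟨fun j => by simp, fun j m hm => ?_⟩
  obtain rfl : m = 0 := by simpa using hm
  simp

lemma up0 [∀ n, Fintype (E n)] (hne : NonErasing σ) (n : ℕ) {x : ℤ → E 0} (hx : x ∈ XLevel σ 0) :
    ∃ y c, y ∈ XLevel σ n ∧ Cat (word0 σ n) y c x ∧ c 0 ≤ 0 ∧ 0 < c 1 := by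
  induction n with
  | zero => exact ⟨x, id, hx, cat_id x, by simp, by simp⟩
  | succ n ih =>
    obtain ⟨y, c, hy, hc, h0, h1⟩ := ih
    obtain ⟨y', d, hy', hd, g0, g1⟩ := up hne hy
    have hm := (hc.mono (word0_ne hne n)).monotone
    exact ⟨y', fun j => c (d j), hy', hd.comp hc, (hm g0).trans h0,
      h1.trans_le (hm (by omega))⟩

lemma repU0 (hne : NonErasing σ) (hrec : RecognizableSeq σ) (n : ℕ) :
    RepU (word0 σ n) (XLevel σ n) := by
  induction n with
  | zero =>
    intro x y y' c c' _ _ hc hc' h0 h1 h0' h1'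
    have key : ∀ (y : ℤ → E 0) c, Cat (word0 σ 0) y c x → c 0 ≤ 0 → 0 < c 1 → y = x ∧ c = id := by
      intro y c hc h0 h1
      have s := hc.1
      simp only [word0, List.length_singleton] at s
      have e : c = id := by
        have := s 0
        rw [zero_add] at this
        push_cast at this
        exact eq_of_steps (s := fun _ => 1) (by simpa using s) (fun j => rfl)
          (show c 0 = 0 by omega)
      refine ⟨funext fun j => ?_, e⟩
      have := hc.2 j 0 (by simp [word0])
      simpa [word0, e] using this
    obtain ⟨a1, a2⟩ := key y c hc h0 h1
    obtain ⟨b1, b2⟩ := key y' c' hc' h0' h1'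
    exact ⟨a1.trans b1.symm, a2.trans b2.symm⟩
  | succ n ih =>
    exact repU_comp (hne n) (word0_ne hne n) (xlevel_inv n) (fun y hy d u h => cat_down hne hy h)
      (repU_of_rec (hrec n)) ih

lemma two_le_card [∀ n, Fintype (E n)] (hne : NonErasing σ) {x : ℤ → E 0} (hx : x ∈ XLevel σ 0)
    (hap : IsAperiodicPoint x) (n : ℕ) : 1 < Fintype.card (E n) := by
  by_contra hle
  push Not at hle
  have hsub : Subsingleton (E n) := Fintype.card_le_one_iff_subsingleton.mp hle
  obtain ⟨y, c, -, hc, -, -⟩ := up0 hne n hx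
  apply hap
  obtain ⟨L, hL⟩ : ∃ L, L = (word0 σ n (y 0)).length := ⟨_, rfl⟩
  refine ⟨L, by rw [hL]; exact List.length_pos_iff.mpr (word0_ne hne n _), fun i => ?_⟩
  obtain ⟨j, h1, h2⟩ := cut_exists (hc.mono (word0_ne hne n)) i
  have e1 : y j = y 0 := Subsingleton.elim _ _
  have e2 : y (j + 1) = y 0 := Subsingleton.elim _ _
  have s := hc.1 j
  rw [e1, ← hL] at s
  have a := hc.2 j (i - c j).toNat (by rw [e1, ← hL]; omega)
  have b := hc.2 (j + 1) (i - c j).toNat (by rw [e2, ← hL]; omega)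
  rw [e1] at a
  rw [e2, a] at b
  have := Option.some.inj b
  convert this.symm using 2 <;> omega

lemma word0_add (m k : ℕ) (a : E (m + k)) :
    word0 σ (m + k) a = (sadicWordAux σ m k a).flatMap (word0 σ m) := by
  induction k with
  | zero => simp [sadicWordAux]
  | succ k ih =>
    show (σ (m + k) a).flatMap (word0 σ (m + k)) =
      ((σ (m + k) a).flatMap (sadicWordAux σ m k)).flatMap (word0 σ m)
    rw [List.flatMap_assoc]
    congr 1
    funext b
    exact ih b

lemma length_flatMap_ge {f : A → List B} {L : ℕ} (h : ∀ a, L ≤ (f a).length) (u : List A) :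
    u.length * L ≤ (u.flatMap f).length := by
  induction u with
  | nil => simp
  | cons a u ih =>
    rw [List.flatMap_cons, List.length_append, List.length_cons, Nat.succ_mul]
    have := h a
    omega

lemma word0_long [∀ n, Fintype (E n)] (hne : NonErasing σ) (hprim : PrimitiveSeq σ)
    (hcard : ∀ n, 1 < Fintype.card (E n)) (L : ℕ) : ∃ m, ∀ a, L ≤ (word0 σ m a).length := by
  classical
  induction L with
  | zero => exact ⟨0, fun a => Nat.zero_le _⟩
  | succ L ih =>
    obtain ⟨m, hm⟩ := ih
    obtain ⟨k, hk, hall⟩ := hprim m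
    refine ⟨m + k, fun a => ?_⟩
    rw [word0_add]
    have h2 : 2 ≤ (sadicWordAux σ m k a).length := by
      have h3 : (Finset.univ : Finset (E m)) ⊆ (sadicWordAux σ m k a).toFinset := fun b _ => by
        rw [List.mem_toFinset]; exact hall a b
      have h4 := Finset.card_le_card h3
      have h5 := List.toFinset_card_le (sadicWordAux σ m k a)
      have h6 := hcard m
      rw [Finset.card_univ] at h4
      omega
    have h7 := length_flatMap_ge (f := word0 σ m) (L := max L 1) (fun b => by
      have := hm b
      have := List.length_pos_iff.mpr (word0_ne hne m b)
      omega) (sadicWordAux σ m k a)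
    have h8 : 2 * max L 1 ≤ (sadicWordAux σ m k a).length * max L 1 := Nat.mul_le_mul_right _ h2
    omega

lemma word0_prefix {m : ℕ} {b : E m} (hb : ∀ a : E (m + 1), (σ m a).head? = some b)
    (hne : NonErasing σ) (k : ℕ) : ∀ a : E (m + 1 + k), word0 σ m b <+: word0 σ (m + 1 + k) a := by
  induction k with
  | zero =>
    intro a
    have := hb a
    obtain ⟨t, ht⟩ := List.head?_eq_some_iff.mp this
    show word0 σ m b <+: (σ m a).flatMap (word0 σ m)
    rw [ht, List.flatMap_cons]
    exact List.prefix_append _ _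
  | succ k ih =>
    intro a
    show word0 σ m b <+: (σ (m + 1 + k) a).flatMap (word0 σ (m + 1 + k))
    obtain ⟨b', t, ht⟩ := List.exists_cons_of_ne_nil (hne (m + 1 + k) a)
    rw [ht, List.flatMap_cons]
    exact (ih b').trans (List.prefix_append _ _)

lemma deep_sadic [∀ n, Fintype (E n)] (hne : NonErasing σ) (hprim : PrimitiveSeq σ)
    (hprop : ProperSeq σ) (hrec : RecognizableSeq σ) (hrank : AlphabetRankLE E 2)
    (hX : (XLevel σ 0).Nonempty) (hap : ∀ x ∈ XLevel σ 0, IsAperiodicPoint x) :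
    Deep (XLevel σ 0) := by
  classical
  intro d
  obtain ⟨x0, hx0⟩ := hX
  have hcard := two_le_card hne hx0 (hap x0 hx0)
  obtain ⟨m, hm⟩ := word0_long hne hprim hcard d
  obtain ⟨b, b', hb⟩ := hprop m
  obtain ⟨n, hn, hn2⟩ := hrank (m + 1)
  obtain ⟨k, rfl⟩ := Nat.exists_eq_add_of_le hn
  have hc2 : Fintype.card (E (m + 1 + k)) = Fintype.card Bool := by
    have := hcard (m + 1 + k)
    rw [Fintype.card_bool]; omega
  obtain ⟨e⟩ := Fintype.card_eq.mp hc2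
  have : Nonempty (E (m + 1 + k)) := ⟨e.symm true⟩
  obtain ⟨r, h, hloc, hh⟩ := str_of_rep (word0_ne hne (m + 1 + k)) (InL σ (m + 1 + k))
    (xlevel_eq _) (xlevel_inv _) (repU0 hne hrec _)
  let w : Bool → List (E 0) := fun c => word0 σ (m + 1 + k) (e.symm c)
  have hS : Str (XLevel σ 0) ((fun x i => (e (h x i).1, (h x i).2)) '' XLevel σ 0) w := by
    refine ⟨r, _, ?_, ?_, rfl⟩
    · intro x y i i' hxy
      have := hloc x y i i' hxy
      simp only [this]
    · intro x hx
      obtain ⟨y, c, hy, hc, h0, h1⟩ := up0 hne (m + 1 + k) hx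
      obtain ⟨t1, t2⟩ := hh x y c hy hc h0 h1
      refine ⟨fun i => ?_, fun i => ?_⟩
      · rcases t1 i with ⟨a1, a2⟩ | ⟨a1, a2⟩
        · left
          refine ⟨by simpa [len, w] using a1, ?_⟩
          simp only [a2]
        · right
          exact ⟨by simpa [len, w] using a1, a2⟩
      · simpa [w] using t2 i
  refine ⟨_, w, hS, ?_⟩
  have hnc := hS.nonC ⟨x0, hx0⟩ hap
  have hA : d ≤ dA w := by
    refine le_lcpLen hnc fun i hi => ?_
    have hd := hm b
    obtain ⟨t, ht⟩ := word0_prefix (fun a => (hb a).1) hne k (e.symm false)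
    obtain ⟨t', ht'⟩ := word0_prefix (fun a => (hb a).1) hne k (e.symm true)
    have e1 : w false = word0 σ m b ++ t := ht.symm
    have e2 : w true = word0 σ m b ++ t' := ht'.symm
    rw [e1, e2]
    rw [List.append_assoc, List.append_assoc, List.getElem?_append_left (by omega),
      List.getElem?_append_left (by omega)]
  have : dA w ≤ depth w := Nat.le_add_right _ _
  omega

end sadic

theorem deep_of_T2 (X : SubshiftSpace) (hX : X ∈ T2Set) : Deep X.carrier := by
  obtain ⟨-, hap, E, iE, σ, hne, hprim, hprop, hrec, hrank, hconj⟩ := hX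
  letI : TopologicalSpace (E 0) := ⊥
  have : DiscreteTopology (E 0) := ⟨rfl⟩
  obtain ⟨f, g, hl⟩ := lconj_of_conjugate X.compact X.inv X.nonempty hconj
  obtain ⟨D, e, -, h2⟩ := exists_trans hl X.compact X.inv X.nonempty hap
  obtain ⟨x, hx⟩ := X.nonempty
  exact Deep.trans h2 (deep_sadic hne hprim hprop hrec hrank ⟨f x, hl.mapf x hx⟩ (hl.aper hap))

/-- The conjugacy relation on `𝐓₂` is hyperfinite: it is the
increasing union of finite Borel equivalence relations on `𝐓₂`. -/
theorem statement14 :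
    ∃ F : ℕ → Set (SubshiftSpace × SubshiftSpace),
      (∀ k, F k ⊆ T2Set ×ˢ T2Set) ∧
      (∀ k, ∀ X ∈ T2Set, (X, X) ∈ F k) ∧
      (∀ k X Y, (X, Y) ∈ F k → (Y, X) ∈ F k) ∧
      (∀ k X Y Z, (X, Y) ∈ F k → (Y, Z) ∈ F k → (X, Z) ∈ F k) ∧
      (∀ k X, {Y | (X, Y) ∈ F k}.Finite) ∧
      (∀ k, ∃ Bk : Set (SubshiftSpace × SubshiftSpace),
        @MeasurableSet _ (borel (SubshiftSpace × SubshiftSpace)) Bk ∧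
        F k = Bk ∩ T2Set ×ˢ T2Set) ∧
      (∀ k, F k ⊆ F (k+1)) ∧
      (⋃ k, F k) = {p : SubshiftSpace × SubshiftSpace |
        p.1 ∈ T2Set ∧ p.2 ∈ T2Set ∧ Conjugate p.1.carrier p.2.carrier} :=
  main_of_deep deep_of_T2

end ToeplitzFR
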